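/- arXiv:1802.00256 — 6 statements merged into one kernel-verified Lean document; each statement's English description precedes it below -/
import Mathlib

section
/- Let Ω be an algebraically closed field and let E ⊆ A ⊆ C be subfields of Ω. If the extension E ⊆ C is regular (that is, C and alg(E) are linearly disjoint over E), then alg(E)·A ∩ C = E·A (note that E·A = A since E ⊆ A). -/
/-- The relative algebraic closure of a subfield `E` inside `Ω`: the subfield of all
elements of `Ω` that are algebraic (equivalently, integral) over `E`. -/
def algClo {Ω : Type*} [Field Ω] (E : Subfield Ω) : Subfield Ω where
  carrier := {x : Ω | IsIntegral E x}
  mul_mem' := fun ha hb => ha.mul hb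
  one_mem' := isIntegral_one
  add_mem' := fun ha hb => ha.add hb
  zero_mem' := isIntegral_zero
  neg_mem' := fun ha => ha.neg
  inv_mem' := fun _ hx => hx.inv

/-- `A` and `B` are linearly disjoint over a common subfield `k`: every finite
`k`-linearly independent family of elements of `A` is linearly independent over `B`. -/
def LinearDisjointOver {Ω : Type*} [Field Ω] (k A B : Subfield Ω) : Prop :=
  ∀ (n : ℕ) (f : Fin n → Ω), (∀ i, f i ∈ A) →
    LinearIndependent k f → LinearIndependent B f

theorem exists_finset_mem_span_of_mem_sup {Ω : Type*} [Field Ω] {L A : Subfield Ω}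
    (hL : ∀ l ∈ L, IsIntegral A l) {x : Ω} (hx : x ∈ L ⊔ A) :
    ∃ t : Finset Ω, (t : Set Ω) ⊆ A ∧ x ∈ Submodule.span L (t : Set Ω) := by
  have hle : L ⊔ A ≤ (IntermediateField.adjoin A (L : Set Ω)).toSubfield :=
    sup_le (fun l hl => IntermediateField.subset_adjoin A (L : Set Ω) hl)
      (fun a ha => (IntermediateField.adjoin A (L : Set Ω)).algebraMap_mem ⟨a, ha⟩)
  have hx₁ : x ∈ Algebra.adjoin A (L : Set Ω) := by
    rw [← IntermediateField.adjoin_toSubalgebra_of_isAlgebraic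
      (fun l hl => (hL l hl).isAlgebraic)]
    exact hle hx
  have hx₂ : x ∈ Algebra.adjoin L (A : Set Ω) := by
    clear hx
    induction hx₁ using Algebra.adjoin_induction with
    | mem l hl => exact (Algebra.adjoin L (A : Set Ω)).algebraMap_mem ⟨l, hl⟩
    | algebraMap a => exact Algebra.subset_adjoin a.2
    | add _ _ _ _ h₁ h₂ => exact add_mem h₁ h₂
    | mul _ _ _ _ h₁ h₂ => exact mul_mem h₁ h₂
  have hx₃ : x ∈ Submodule.span L (A : Set Ω) := by
    have hA : (Submonoid.closure (A : Set Ω) : Set Ω) = A :=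
      congrArg SetLike.coe (Submonoid.closure_eq A.toSubmonoid)
    rwa [← Subalgebra.mem_toSubmodule, Algebra.adjoin_eq_span, hA] at hx₂
  exact Submodule.mem_span_finite_of_mem_span hx₃

theorem LinearDisjointOver.mem_span_of_mem_span {Ω : Type*} [Field Ω] {k C L : Subfield Ω}
    (h : LinearDisjointOver k C L) (hkL : k ≤ L) {t : Finset Ω} (ht : (t : Set Ω) ⊆ C)
    {x : Ω} (hxC : x ∈ C) (hx : x ∈ Submodule.span L (t : Set Ω)) :
    x ∈ Submodule.span k (t : Set Ω) := by
  obtain ⟨b, hbt, hspan, hb⟩ := exists_linearIndependent k (t : Set Ω)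
  have : Finite b := t.finite_toSet.subset hbt
  obtain ⟨n, ⟨e⟩⟩ := Finite.exists_equiv_fin b
  by_contra hxt
  let f : Fin (n + 1) → Ω := Fin.cons x (fun i => (e.symm i : Ω))
  have hrange : Set.range (fun i => (e.symm i : Ω)) = b := by
    rw [← Function.comp_def Subtype.val, EquivLike.range_comp, Subtype.range_coe]
  have hf : LinearIndependent k f :=
    linearIndependent_finCons.2 ⟨hb.comp _ e.symm.injective, by rwa [hrange, hspan]⟩
  have hfL : LinearIndependent L f :=
    h _ f (Fin.cases hxC fun i => ht (hbt (e.symm i).2)) hf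
  refine (linearIndependent_finCons.1 hfL).2 ?_
  rw [hrange]
  refine Submodule.span_le.2 (fun y hy => ?_) hx
  have hy' : y ∈ Submodule.span k b := hspan ▸ Submodule.subset_span hy
  clear hy
  induction hy' using Submodule.span_induction with
  | mem z hz => exact Submodule.subset_span hz
  | zero => exact zero_mem _
  | add _ _ _ _ h₁ h₂ => exact add_mem h₁ h₂
  | smul c z _ hz => exact Submodule.smul_mem _ (⟨c, hkL c.2⟩ : L) hz

theorem stmt0 {Ω : Type*} [Field Ω] [IsAlgClosed Ω] (E A C : Subfield Ω)
    (hEA : E ≤ A) (hAC : A ≤ C)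
    (hreg : LinearDisjointOver E C (algClo E)) :
    (algClo E ⊔ A) ⊓ C = E ⊔ A := by
  have hE : E ≤ algClo E := fun x hx =>
    (isIntegral_algebraMap (R := E) (A := Ω) (x := ⟨x, hx⟩))
  refine le_antisymm ?_ (le_inf (sup_le_sup_right hE A) (sup_le (hEA.trans hAC) hAC))
  rintro x ⟨hx, hxC⟩
  have hint : ∀ l ∈ algClo E, IsIntegral A l := fun l hl =>
    IsIntegral.map_of_comp_eq (Subfield.inclusion hEA) (RingHom.id Ω) rfl hl
  obtain ⟨t, htA, hxt⟩ := exists_finset_mem_span_of_mem_sup hint hx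
  have hxE := hreg.mem_span_of_mem_span hE (htA.trans hAC) hxC hxt
  refine le_sup_right (a := E) ?_
  clear hx hxC hxt
  induction hxE using Submodule.span_induction with
  | mem z hz => exact htA hz
  | zero => exact zero_mem _
  | add _ _ _ _ h₁ h₂ => exact add_mem h₁ h₂
  | smul c z _ hz => exact mul_mem (hEA c.2) hz
end

section
/- Let Ω be an algebraically closed field and let E ⊆ A ⊆ C be subfields of Ω. If the extension A ⊆ C is regular (that is, C and alg(A) are linearly disjoint over A), then alg(E)·C ∩ alg(A) = alg(E)·A. -/
theorem isIntegral_subfield_of_le {Ω : Type*} [Field Ω] {E F : Subfield Ω} (h : E ≤ F) {x : Ω}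
    (hx : IsIntegral E x) : IsIntegral F x := by
  let := (Subfield.inclusion h).toAlgebra
  have : IsScalarTower E F Ω := IsScalarTower.of_algebraMap_eq fun _ => rfl
  exact hx.tower_top

theorem algClo_mono {Ω : Type*} [Field Ω] {E F : Subfield Ω} (h : E ≤ F) :
    algClo E ≤ algClo F := fun _ hx => isIntegral_subfield_of_le h hx

theorem le_algClo {Ω : Type*} [Field Ω] (E : Subfield Ω) : E ≤ algClo E :=
  fun x hx => isIntegral_algebraMap (R := E) (A := Ω) (x := ⟨x, hx⟩)

theorem LinearDisjointOver.linearIndepOn {Ω : Type*} [Field Ω] {k A B : Subfield Ω}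
    (h : LinearDisjointOver k A B) {s : Set Ω} (hsA : s ⊆ A) (hs : LinearIndepOn k id s) :
    LinearIndepOn B id s := by
  refine linearIndepOn_of_finite s fun t hts ht => ?_
  have := ht.fintype
  let e := Fintype.equivFin t
  exact (linearIndependent_equiv e.symm).1
    (h _ (fun i => ((e.symm i : t) : Ω)) (fun i => hsA (hts (e.symm i).2))
      ((linearIndependent_equiv e.symm).2 (hs.mono hts)))

theorem mem_of_mem_span_of_linearIndepOn {Ω : Type*} [Field Ω] {K L : Subfield Ω} (hKL : K ≤ L)
    {s : Set Ω} (h1 : (1 : Ω) ∈ s) (hs : LinearIndepOn L id s) {x : Ω} (hxL : x ∈ L)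
    (hx : x ∈ Submodule.span K s) : x ∈ K := by
  obtain ⟨c, hc, rfl⟩ := Submodule.mem_span_set.1 hx
  set x := c.sum fun m r => r • m
  let l : Ω →₀ L := c.mapRange (Subfield.inclusion hKL) (map_zero _)
  have hl : l = Finsupp.single 1 ⟨x, hxL⟩ := by
    refine linearIndepOn_iffₛ.1 hs _ ?_ _ ?_ ?_
    · exact (Finset.coe_subset.2 Finsupp.support_mapRange).trans hc
    · exact Finsupp.single_mem_supported _ _ h1
    · rw [Finsupp.linearCombination_single, Finsupp.linearCombination_apply,
        Finsupp.sum_mapRange_index (by simp)]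
      simp only [id, Subfield.smul_def, smul_eq_mul, mul_one]
      rfl
  have h := congrArg (fun f : Ω →₀ L => (f 1 : Ω)) hl
  have hx1 : (c 1 : Ω) = x := by
    simp only [l, Finsupp.mapRange_apply, Finsupp.single_eq_same] at h
    exact h
  exact hx1 ▸ (c 1).2

theorem mem_span_of_mem_algClo_sup {Ω : Type*} [Field Ω] {E C : Subfield Ω} (hEC : E ≤ C)
    {x : Ω} (hx : x ∈ algClo E ⊔ C) : x ∈ Submodule.span C (algClo E : Set Ω) := by
  have hle : algClo E ⊔ C ≤ (IntermediateField.adjoin C (algClo E : Set Ω)).toSubfield :=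
    sup_le (IntermediateField.subset_adjoin C _)
      fun y hy => (IntermediateField.adjoin C (algClo E : Set Ω)).algebraMap_mem ⟨y, hy⟩
  have hint : ∀ y ∈ (algClo E : Set Ω), IsAlgebraic C y := fun y hy =>
    (isIntegral_subfield_of_le hEC hy).isAlgebraic
  have hx' : x ∈ (IntermediateField.adjoin C (algClo E : Set Ω)).toSubalgebra := hle hx
  rw [IntermediateField.adjoin_toSubalgebra_of_isAlgebraic hint,
    ← Subalgebra.mem_toSubmodule, Algebra.adjoin_eq_span] at hx'
  have hcl : (Submonoid.closure (algClo E : Set Ω) : Set Ω) = algClo E :=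
    congrArg _ (Submonoid.closure_eq (algClo E).toSubmonoid)
  rwa [hcl] at hx'

theorem stmt1 {Ω : Type*} [Field Ω] [IsAlgClosed Ω] (E A C : Subfield Ω)
    (hEA : E ≤ A) (hAC : A ≤ C)
    (hreg : LinearDisjointOver A C (algClo A)) :
    (algClo E ⊔ C) ⊓ algClo A = algClo E ⊔ A := by
  have hKL : algClo E ⊔ A ≤ algClo A := sup_le (algClo_mono hEA) (le_algClo A)
  refine le_antisymm ?_ (le_inf (sup_le_sup_left hAC _) hKL)
  rintro x ⟨hx, hxA⟩
  obtain ⟨b, hbC, h1b, hCb, hb⟩ := exists_linearIndepOn_id_extension (K := A) (V := Ω)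
    (s := {1}) (t := C) (LinearIndepOn.singleton one_ne_zero)
    (Set.singleton_subset_iff.2 C.one_mem)
  refine mem_of_mem_span_of_linearIndepOn hKL (h1b rfl) (hreg.linearIndepOn hbC hb) hxA ?_
  have hC : ∀ c ∈ C, c ∈ Submodule.span (algClo E ⊔ A : Subfield Ω) b := fun c hc => by
    have hcA := hCb hc
    clear hc
    induction hcA using Submodule.span_induction with
    | mem y hy => exact Submodule.subset_span hy
    | zero => exact zero_mem _
    | add y z _ _ hy hz => exact add_mem hy hz
    | smul a y _ hy =>
      exact Submodule.smul_mem _ (⟨a, le_sup_right (a := algClo E) a.2⟩ :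
        (algClo E ⊔ A : Subfield Ω)) hy
  obtain ⟨f, hf, rfl⟩ := Submodule.mem_span_set.1 (mem_span_of_mem_algClo_sup (hEA.trans hAC) hx)
  refine sum_mem fun e he => ?_
  change (f e : Ω) * e ∈ _
  rw [mul_comm]
  exact Submodule.smul_mem _ (⟨e, le_sup_left (b := A) (hf he)⟩ :
    (algClo E ⊔ A : Subfield Ω)) (hC _ (f e).2)
end

section
/- Let Ω be an algebraically closed field of characteristic 0 and let F₀ ⊆ K be subfields of Ω such that every element of K algebraic over F₀ lies in F₀ (so F₀ ⊆ K is a regular extension). Then for every element ε of the compositum alg(F₀)·K there exists b ∈ alg(F₀) such that K(ε) = K(b) (as subfields of Ω). -/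
open IntermediateField in
/-- In a tower `F ⊆ K ⊆ E` of characteristic zero, adjoining to `K` finitely many elements integral
over `F` is the same as adjoining a single element integral over `F`. -/
theorem exists_isIntegral_adjoin_simple_eq_adjoin_finset {F K E : Type*} [Field F] [Field K]
    [Field E] [CharZero F] [Algebra F K] [Algebra K E] [Algebra F E] [IsScalarTower F K E]
    (S : Finset E) (hS : ∀ x ∈ S, IsIntegral F x) :
    ∃ b : E, IsIntegral F b ∧ K⟮b⟯ = adjoin K (S : Set E) := by
  have : FiniteDimensional F (adjoin F (S : Set E)) := finiteDimensional_adjoin hS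
  obtain ⟨b, hb⟩ := Field.exists_primitive_element F (adjoin F (S : Set E))
  have hb' : F⟮(b : E)⟯ = adjoin F (S : Set E) := by
    rw [← lift_adjoin_simple, hb, lift_top]
  have hle {T U : Set E} (h : T ⊆ adjoin F U) : adjoin K T ≤ adjoin K U := by
    have hFK : adjoin F U ≤ (adjoin K U).restrictScalars F :=
      adjoin_le_iff.mpr (subset_adjoin K U)
    exact adjoin_le_iff.mpr fun x hx ↦ hFK (h hx)
  refine ⟨b, (Algebra.IsIntegral.isIntegral (R := F) b).map (adjoin F (S : Set E)).val,
    le_antisymm (hle ?_) (hle ?_)⟩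
  · simp
  · rw [hb']
    exact subset_adjoin F _

open IntermediateField Polynomial in
/-- In a tower `F ⊆ K ⊆ E`, every element of `K(a)` with `a` integral over `F` generates over `K`
the same field as some finite set of elements integral over `F`. -/
theorem exists_finset_isIntegral_adjoin_simple_eq {F K E : Type*} [Field F] [Field K]
    [Field E] [Algebra F K] [Algebra K E] [Algebra F E] [IsScalarTower F K E]
    {a ε : E} (ha : IsIntegral F a) (hε : ε ∈ K⟮a⟯) :
    ∃ S : Finset E, (∀ x ∈ S, IsIntegral F x) ∧ K⟮ε⟯ = adjoin K (S : Set E) := by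
  classical
  have : FiniteDimensional K K⟮a⟯ := adjoin.finiteDimensional ha.tower_top
  let α : K⟮a⟯ := AdjoinSimple.gen K a
  have hα : IsIntegral F α :=
    (isIntegral_algHom_iff (K⟮a⟯.val.restrictScalars F) Subtype.val_injective).mp ha
  have hprim : adjoin K {α} = ⊤ := by
    apply lift_injective
    rw [lift_adjoin_simple, lift_top]
    rfl
  let N : IntermediateField K K⟮a⟯ := adjoin K {⟨ε, hε⟩}
  let g := (minpoly N α).map (algebraMap N K⟮a⟯)
  have hg : adjoin K (g.coeffs : Set K⟮a⟯) = N :=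
    adjoin_minpoly_coeff_of_exists_primitive_element K hprim N
  have : IsScalarTower F N K⟮a⟯ := .of_algebraMap_eq fun _ ↦ rfl
  have hdvd : g ∣ (minpoly F α).map (algebraMap F K⟮a⟯) := by
    rw [IsScalarTower.algebraMap_eq F N K⟮a⟯, ← Polynomial.map_map]
    exact Polynomial.map_dvd _ (minpoly.dvd_map_of_isScalarTower F N α)
  have hlifts := integralClosure.mem_lifts_of_monic_of_dvd_map K⟮a⟯ (minpoly.monic hα)
    ((minpoly.monic hα.tower_top).map _) hdvd
  refine ⟨g.coeffs.image Subtype.val, ?_, ?_⟩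
  · simp only [Finset.mem_image, mem_coeffs_iff]
    rintro _ ⟨_, ⟨n, -, rfl⟩, rfl⟩
    obtain ⟨y, hy⟩ := (lifts_iff_coeff_lifts g).mp hlifts n
    rw [← hy]
    exact y.2.map (K⟮a⟯.val.restrictScalars F)
  · rw [Finset.coe_image, ← lift_adjoin, hg, lift_adjoin_simple]

open IntermediateField in
theorem stmt3 {Ω : Type*} [Field Ω] [IsAlgClosed Ω] [CharZero Ω]
    (F₀ K : Subfield Ω) (hF₀K : F₀ ≤ K)
    (hreg : algClo F₀ ⊓ K ≤ F₀) :
    ∀ ε ∈ algClo F₀ ⊔ K, ∃ b ∈ algClo F₀,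
      Subfield.closure ((K : Set Ω) ∪ {ε}) = Subfield.closure ((K : Set Ω) ∪ {b}) := by
  intro ε hε
  let : Algebra F₀ K := (Subfield.inclusion hF₀K).toAlgebra
  have : IsScalarTower F₀ K Ω := .of_algebraMap_eq fun _ ↦ rfl
  have hadj (S : Set Ω) : (adjoin K S).toSubfield = Subfield.closure ((K : Set Ω) ∪ S) := by
    rw [adjoin_toSubfield, show Set.range (algebraMap K Ω) = K from Subtype.range_coe]
  have hmem : ε ∈ adjoin K (algClo F₀ : Set Ω) := by
    rw [← mem_toSubfield, hadj, Subfield.closure_union, Subfield.closure_eq, Subfield.closure_eq,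
      sup_comm]
    exact hε
  obtain ⟨T, hT, hεT⟩ := exists_finset_of_mem_adjoin hmem
  obtain ⟨a, ha, haT⟩ :=
    exists_isIntegral_adjoin_simple_eq_adjoin_finset (F := F₀) (K := K) T fun x hx ↦ hT hx
  obtain ⟨S, hS, hεS⟩ := exists_finset_isIntegral_adjoin_simple_eq ha (haT ▸ hεT)
  obtain ⟨b, hb, hbS⟩ := exists_isIntegral_adjoin_simple_eq_adjoin_finset (K := K) S hS
  exact ⟨b, hb, by rw [← hadj, ← hadj, hεS, hbS]⟩
end

section
/- Let p and ℓ be distinct prime numbers and let a, b ∈ ℚ_p be elements that are not both zero. Then ‖b‖_p ≤ ‖a‖_p (equivalently, v_p(a) ≤ v_p(b)) if and only if a^ℓ + p·b^ℓ is a nonzero ℓ-th power in ℚ_p. -/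
open Polynomial in
/-- A `p`-adic integer congruent to `1` modulo `p` is an `n`-th power when `p` does not divide
`n`. -/
theorem PadicInt.exists_pow_eq_one_add_p_mul {p n : ℕ} [Fact p.Prime] (hn : p.Coprime n)
    (c : ℤ_[p]) : ∃ z : ℤ_[p], z ^ n = 1 + p * c := by
  have hderiv : ‖(X ^ n - C (1 + (p : ℤ_[p]) * c)).derivative.aeval (1 : ℤ_[p])‖ = 1 := by
    simpa [derivative_X_pow] using hn
  have hnorm : ‖(X ^ n - C (1 + (p : ℤ_[p]) * c)).aeval (1 : ℤ_[p])‖ <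
      ‖(X ^ n - C (1 + (p : ℤ_[p]) * c)).derivative.aeval (1 : ℤ_[p])‖ ^ 2 := by
    rw [hderiv, one_pow, PadicInt.norm_lt_one_iff_dvd]
    simp
  obtain ⟨z, hz, -⟩ := hensels_lemma hnorm
  exact ⟨z, by simpa [sub_eq_zero] using hz⟩

theorem PadicInt.one_add_p_mul_ne_zero {p : ℕ} [Fact p.Prime] (c : ℤ_[p]) :
    1 + (p : ℤ_[p]) * c ≠ 0 := by
  intro h
  exact PadicInt.prime_p.not_isUnit
    (isUnit_iff_dvd_one.2 ⟨-c, by linear_combination h⟩)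

/-- If `p` divides `a`, then `a ^ n + p` has valuation one, so it is not an `n`-th power. -/
theorem PadicInt.pow_ne_pow_add_p {p n : ℕ} [Fact p.Prime] (hn : 2 ≤ n) {a : ℤ_[p]}
    (ha : (p : ℤ_[p]) ∣ a) (y : ℤ_[p]) : y ^ n ≠ a ^ n + p := by
  intro h
  have hy : (p : ℤ_[p]) ∣ y := by
    apply PadicInt.prime_p.dvd_of_dvd_pow (n := n)
    rw [h]
    exact dvd_add (dvd_pow ha (by omega)) dvd_rfl
  have hsq {x : ℤ_[p]} (hx : (p : ℤ_[p]) ∣ x) : (p : ℤ_[p]) ^ 2 ∣ x ^ n :=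
    (pow_dvd_pow_of_dvd hx 2).trans (pow_dvd_pow x hn)
  have hp : (p : ℤ_[p]) ^ 2 ∣ (p : ℤ_[p]) ^ 1 := by
    simpa [h] using dvd_sub (hsq hy) (hsq ha)
  have := (pow_dvd_pow_iff PadicInt.prime_p.ne_zero PadicInt.prime_p.not_isUnit).1 hp
  omega

theorem stmt4 (p ℓ : ℕ) [Fact p.Prime] [Fact ℓ.Prime] (hpl : p ≠ ℓ)
    (a b : ℚ_[p]) (hab : ¬(a = 0 ∧ b = 0)) :
    ‖b‖ ≤ ‖a‖ ↔
      (a ^ ℓ + (p : ℚ_[p]) * b ^ ℓ ≠ 0 ∧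
        ∃ y : ℚ_[p], y ^ ℓ = a ^ ℓ + (p : ℚ_[p]) * b ^ ℓ) := by
  have hp : p.Prime := Fact.out
  have hℓ : ℓ.Prime := Fact.out
  constructor
  · intro h
    have ha : a ≠ 0 := by
      rintro rfl
      exact hab ⟨rfl, by simpa using h⟩
    obtain ⟨c, hc⟩ : ∃ c : ℤ_[p], (c : ℚ_[p]) = b / a := by
      refine ⟨⟨b / a, ?_⟩, rfl⟩
      rw [norm_div]
      exact div_le_one_of_le₀ h (norm_nonneg a)
    have hfactor : a ^ ℓ + (p : ℚ_[p]) * b ^ ℓ =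
        a ^ ℓ * ((1 + (p : ℤ_[p]) * c ^ ℓ : ℤ_[p]) : ℚ_[p]) := by
      push_cast [hc]
      rw [div_pow]
      field_simp
    rw [hfactor]
    refine ⟨mul_ne_zero (pow_ne_zero ℓ ha)
      (PadicInt.coe_ne_zero.2 (PadicInt.one_add_p_mul_ne_zero _)), ?_⟩
    obtain ⟨z, hz⟩ :=
      PadicInt.exists_pow_eq_one_add_p_mul ((Nat.coprime_primes hp hℓ).2 hpl) (c ^ ℓ)
    exact ⟨a * z, by rw [mul_pow, ← hz, PadicInt.coe_pow]⟩
  · rintro ⟨-, y, hy⟩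
    by_contra! h
    have hb : b ≠ 0 := norm_pos_iff.1 ((norm_nonneg a).trans_lt h)
    have ha : ‖a / b‖ < 1 := by
      rw [norm_div]
      exact (div_lt_one (norm_pos_iff.2 hb)).2 h
    obtain ⟨a', ha'⟩ : ∃ a' : ℤ_[p], (a' : ℚ_[p]) = a / b := ⟨⟨a / b, ha.le⟩, rfl⟩
    have hyb : (y / b) ^ ℓ = ((a' ^ ℓ + (p : ℤ_[p]) : ℤ_[p]) : ℚ_[p]) := by
      push_cast [ha']
      rw [div_pow, div_pow, hy]
      field_simp
    obtain ⟨y', hy'⟩ : ∃ y' : ℤ_[p], (y' : ℚ_[p]) = y / b := by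
      refine ⟨⟨y / b, ?_⟩, rfl⟩
      rw [← pow_le_one_iff_of_nonneg (norm_nonneg _) hℓ.ne_zero, ← norm_pow, hyb]
      exact PadicInt.norm_le_one _
    have hpa : (p : ℤ_[p]) ∣ a' := by
      rwa [← PadicInt.norm_lt_one_iff_dvd, PadicInt.norm_def, ha']
    refine PadicInt.pow_ne_pow_add_p hℓ.two_le hpa y' (PadicInt.ext ?_)
    rw [PadicInt.coe_pow, hy', hyb]
end

section
/- Let K be a field equipped with a valuation v : K → Γ₀ into a linearly ordered abelian group with zero, and give K the valuation topology and the space of m×m matrices over K the product topology. Let GL_m(O_v) denote the set of m×m matrices over K all of whose entries x satisfy v(x) ≤ 1 and whose determinant d satisfies v(d) = 1. Then for every invertible m×m matrix g over K, the left coset g·GL_m(O_v) is an open subset of the space of m×m matrices over K. -/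
/-- The elements of valuation one form an open set in the valuation topology. -/
theorem Valued.isOpen_setOf_v_eq_one {K Γ₀ : Type*} [Field K]
    [LinearOrderedCommGroupWithZero Γ₀] [Valued K Γ₀] :
    IsOpen {x : K | Valued.v x = (1 : Γ₀)} := by
  refine isOpen_iff_mem_nhds.2 fun x (hx : Valued.v x = 1) => ?_
  simpa only [hx] using Valued.locally_const (x := x) (by simp [hx])

/-- `GL_m` of the valuation ring is open in the space of matrices. -/
theorem Valued.isOpen_integral_matrix_det_unit {K Γ₀ n : Type*} [Field K]
    [LinearOrderedCommGroupWithZero Γ₀] [Valued K Γ₀] [Fintype n] [DecidableEq n] :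
    IsOpen {h : Matrix n n K |
      (∀ i j, Valued.v (h i j) ≤ (1 : Γ₀)) ∧ Valued.v h.det = (1 : Γ₀)} := by
  refine IsOpen.and ?_ (Valued.isOpen_setOf_v_eq_one.preimage continuous_id.matrix_det)
  simp only [Set.ofPred_forall]
  exact isOpen_iInter_of_finite fun i => isOpen_iInter_of_finite fun j =>
    (Valued.isOpen_integer K).preimage (continuous_id.matrix_elem i j)

theorem stmt8 {K Γ₀ : Type*} [Field K] [LinearOrderedCommGroupWithZero Γ₀]
    [Valued K Γ₀] (m : ℕ) (g : Matrix (Fin m) (Fin m) K) (hg : IsUnit g.det) :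
    IsOpen {x : Matrix (Fin m) (Fin m) K |
      ∃ h : Matrix (Fin m) (Fin m) K,
        ((∀ i j, Valued.v (h i j) ≤ (1 : Γ₀)) ∧ Valued.v h.det = (1 : Γ₀)) ∧
        x = g * h} := by
  have hcont : Continuous fun x : Matrix (Fin m) (Fin m) K => g⁻¹ * x :=
    continuous_const.matrix_mul continuous_id
  convert Valued.isOpen_integral_matrix_det_unit.preimage hcont using 1
  ext x
  constructor
  · rintro ⟨h, hh, rfl⟩
    simpa only [Set.mem_preimage, Matrix.nonsing_inv_mul_cancel_left _ _ hg,
      Set.mem_ofPred_eq] using hh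
  · exact fun hx => ⟨g⁻¹ * x, hx, (Matrix.mul_nonsing_inv_cancel_left _ _ hg).symm⟩
end

section
/- Let p be a prime. Let Ω be a field of characteristic 0, let L₁ and L₂ be subfields of Ω, and let k₀ be a subfield of L₁ ∩ L₂ such that L₁ and L₂ are linearly disjoint over k₀. Suppose K₁ and K₂ are fields elementarily equivalent to ℚ_p in the first-order language of rings, and f₁ : L₁ → K₁ and f₂ : L₂ → K₂ are ring embeddings such that for every integer m ≥ 1 and every a ∈ k₀, f₁(a) is a nonzero m-th power in K₁ if and only if f₂(a) is a nonzero m-th power in K₂. Then there exist a field K elementarily equivalent to ℚ_p in the language of rings and ring embeddings g₁ : L₁ → K and g₂ : L₂ → K that agree on k₀, such that for each j ∈ {1,2}, every integer m ≥ 1 and every a ∈ L_j, g_j(a) is a nonzero m-th power in K if and only if f_j(a) is a nonzero m-th power in K_j. -/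
open FirstOrder

/-- `x` is a nonzero `m`-th power in the field `K`. -/
def IsNonzeroPow {K : Type*} [Field K] (m : ℕ) (x : K) : Prop :=
  x ≠ 0 ∧ ∃ y : K, x = y ^ m

/-- `K` is elementarily equivalent to `ℚ_[p]` in the first-order language of rings. -/
def ElemEquivToQp (p : ℕ) [Fact p.Prime] (K : Type*) [Field K] : Prop :=
  letI := Ring.compatibleRingOfRing K
  letI := Ring.compatibleRingOfRing ℚ_[p]
  Language.ring.ElementarilyEquivalent K ℚ_[p]

universe u

section

open Polynomial Filter

section ValuationTaylor

variable {K Γ : Type*} [Field K] [LinearOrderedCommGroupWithZero Γ] (v : Valuation K Γ)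

theorem Valuation.map_natCast_le_one' (n : ℕ) : v (n : K) ≤ 1 := by
  induction n with
  | zero => simp
  | succ n ih => push_cast; exact v.map_add_le ih (by simp)

/-- Bounds on the Taylor coefficients (from index `k` on) do not depend on the centre of a disc. -/
theorem Valuation.taylor_coeff_le_of_dist_le {G : K[X]} {x a c : K} {B : Γ} {k : ℕ}
    (h : ∀ j, k ≤ j → v ((taylor x G).coeff j * c ^ j) ≤ B) (ha : v (a - x) ≤ v c) (j : ℕ)
    (hj : k ≤ j) : v ((taylor a G).coeff j * c ^ j) ≤ B := by
  have h1 : taylor a G = taylor (a - x) (taylor x G) := by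
    rw [taylor_taylor, sub_add_cancel]
  rw [h1, taylor_coeff, hasseDeriv_apply, sum_def, eval_finsetSum, Finset.sum_mul]
  refine v.map_sum_le fun e _ => ?_
  rw [eval_monomial]
  rcases lt_or_ge e j with hlt | hge
  · simp [Nat.choose_eq_zero_of_lt hlt]
  · refine le_trans ?_ (h e (hj.trans hge))
    have h2 : c ^ e = c ^ (e - j) * c ^ j := by rw [← pow_add, Nat.sub_add_cancel hge]
    rw [h2]
    simp only [map_mul, map_pow]
    calc v (e.choose j : K) * v ((taylor x G).coeff e) * v (a - x) ^ (e - j) * v c ^ j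
        ≤ 1 * v ((taylor x G).coeff e) * v c ^ (e - j) * v c ^ j := by
          gcongr
          exact v.map_natCast_le_one' _
      _ = _ := by rw [one_mul, mul_assoc]

theorem Valuation.eval_sub_eval_le_of_taylor_coeff_le {G : K[X]} {x a c : K} {B : Γ}
    (h : ∀ j, 1 ≤ j → v ((taylor x G).coeff j * c ^ j) ≤ B) (ha : v (a - x) ≤ v c) :
    v (G.eval a - G.eval x) ≤ B := by
  have h1 : G.eval a = (taylor x G).eval (a - x) := by rw [taylor_eval, sub_add_cancel]
  rw [h1, eval_eq_sum_range, Finset.sum_range_succ', taylor_coeff_zero]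
  simp only [pow_zero, mul_one, add_sub_cancel_right]
  refine v.map_sum_le fun e _ => le_trans ?_ (h (e + 1) (by omega))
  simp only [map_mul, map_pow]
  gcongr

/-- If one term of a polynomial dominates at `r`, it approximates the value there. -/
theorem Valuation.eval₂_sub_term_le {F : Type*} [Field F] (i : F →+* K) {g : F[X]} {r : K}
    {B : Γ} {j : ℕ} (h : ∀ k, k ≠ j → v (i (g.coeff k) * r ^ k) ≤ B) :
    v (g.eval₂ i r - i (g.coeff j) * r ^ j) ≤ B := by
  classical
  have hs : g.eval₂ i r = ∑ k ∈ insert j (Finset.range (g.natDegree + 1)),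
      i (g.coeff k) * r ^ k := by
    rw [eval₂_eq_sum_range]
    refine Finset.sum_subset (Finset.subset_insert _ _) fun k _ hk => ?_
    rw [coeff_eq_zero_of_natDegree_lt (by simpa using hk)]
    simp
  rw [hs, ← Finset.add_sum_erase _ _ (Finset.mem_insert_self j _), add_sub_cancel_left]
  exact v.map_sum_le fun k hk => h k (Finset.ne_of_mem_erase hk)

end ValuationTaylor

/-- The first-order properties of the valued field `ℚ_[p]` used below. -/
structure PadicLike (p : ℕ) [Fact p.Prime] {K Γ : Type*} [Field K]
    [LinearOrderedCommGroupWithZero Γ] (v : Valuation K Γ) : Prop where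
  charZero : CharZero K
  lt_one : v (p : K) < 1
  le_of_lt_one : ∀ x, v x < 1 → v x ≤ v (p : K)
  exists_natCast_sub_lt : ∀ x, v x ≤ 1 → ∃ n : ℕ, v (x - n) < 1
  exists_pow_le_natCast : ∀ n : ℕ, n ≠ 0 → ∃ C : ℕ, v (p : K) ^ C ≤ v (n : K)
  exists_root : ∀ g : K[X], v (g.coeff 0) ≤ 1 → g.coeff 1 = 1 →
    (∀ i, 2 ≤ i → v (g.coeff i) < 1) → ∃ y, v y ≤ 1 ∧ g.eval y = 0
  exists_one_add_eq_pow : ∀ n : ℕ, n ≠ 0 → ∃ N : ℕ, ∀ u, v u ≤ v (p : K) ^ N →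
    ∃ w : K, 1 + u = w ^ n
  exists_unit_eq : ∀ n : ℕ, n ≠ 0 → ∀ x, v x = 1 → ∃ q : ℕ, q ≠ 0 ∧ ∃ w : K, v w = 1 ∧ x = q * w ^ n
  exists_eq : ∀ n : ℕ, n ≠ 0 → ∀ x : K, x ≠ 0 → ∃ q : ℕ, q ≠ 0 ∧ ∃ w : K, x = q * w ^ n
  natCast_eq_pow_iff : ∀ n q : ℕ, n ≠ 0 → ((∃ w : K, (q : K) = w ^ n) ↔
    ∃ w : ℚ_[p], (q : ℚ_[p]) = w ^ n)
  le_one_iff : ∀ x, v x ≤ 1 ↔ ∃ y, y ^ (p + 1) = 1 + p * x ^ (p + 1)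

/-- `a` and `b` lie in the class of a common natural number modulo `n`-th powers. -/
def SamePowClass {K₁ K₂ : Type*} [Field K₁] [Field K₂] (n : ℕ) (a : K₁) (b : K₂) : Prop :=
  ∃ q : ℕ, q ≠ 0 ∧ ∃ s t, s ≠ 0 ∧ t ≠ 0 ∧ a = q * s ^ n ∧ b = q * t ^ n

section SamePowClass

variable {K₁ K₂ : Type*} [Field K₁] [Field K₂] {n : ℕ} {a c : K₁} {b d : K₂}

theorem SamePowClass.mul (h : SamePowClass n a b) (h' : SamePowClass n c d) :
    SamePowClass n (a * c) (b * d) := by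
  obtain ⟨q, hq, s, t, hs, ht, rfl, rfl⟩ := h
  obtain ⟨q', hq', s', t', hs', ht', rfl, rfl⟩ := h'
  exact ⟨q * q', mul_ne_zero hq hq', s * s', t * t', mul_ne_zero hs hs', mul_ne_zero ht ht',
    by push_cast; ring, by push_cast; ring⟩

theorem SamePowClass.inv [CharZero K₁] [CharZero K₂] (hn : n ≠ 0) (h : SamePowClass n a b) :
    SamePowClass n a⁻¹ b⁻¹ := by
  obtain ⟨q, hq, s, t, hs, ht, rfl, rfl⟩ := h
  obtain ⟨m, rfl⟩ := Nat.exists_eq_succ_of_ne_zero hn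
  have h1 : (q : K₁) ≠ 0 := by exact_mod_cast hq
  have h2 : (q : K₂) ≠ 0 := by exact_mod_cast hq
  refine ⟨q ^ m, pow_ne_zero _ hq, (q * s)⁻¹, (q * t)⁻¹, by simp [h1, hs], by simp [h2, ht], ?_, ?_⟩
  · push_cast
    rw [inv_pow, mul_pow, Nat.succ_eq_add_one]
    field_simp
    rw [pow_succ']
  · push_cast
    rw [inv_pow, mul_pow, Nat.succ_eq_add_one]
    field_simp
    rw [pow_succ']

theorem SamePowClass.of_dvd {m : ℕ} (hmn : m ∣ n) (hm : n ≠ 0) (h : SamePowClass n a b) :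
    SamePowClass m a b := by
  obtain ⟨q, hq, s, t, hs, ht, rfl, rfl⟩ := h
  obtain ⟨k, rfl⟩ := hmn
  exact ⟨q, hq, s ^ k, t ^ k, pow_ne_zero _ hs, pow_ne_zero _ ht, by rw [← pow_mul, mul_comm k],
    by rw [← pow_mul, mul_comm k]⟩

theorem SamePowClass.left_ne_zero [CharZero K₁] (h : SamePowClass n a b) : a ≠ 0 := by
  obtain ⟨q, hq, s, t, hs, ht, rfl, rfl⟩ := h
  exact mul_ne_zero (by exact_mod_cast hq) (pow_ne_zero _ hs)

theorem SamePowClass.right_ne_zero [CharZero K₂] (h : SamePowClass n a b) : b ≠ 0 := by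
  obtain ⟨q, hq, s, t, hs, ht, rfl, rfl⟩ := h
  exact mul_ne_zero (by exact_mod_cast hq) (pow_ne_zero _ ht)

theorem samePowClass_pow {s : K₁} {t : K₂} (hs : s ≠ 0) (ht : t ≠ 0) :
    SamePowClass n (s ^ n) (t ^ n) :=
  ⟨1, one_ne_zero, s, t, hs, ht, by simp, by simp⟩

end SamePowClass

namespace PadicLike

variable {p : ℕ} [Fact p.Prime] {K Γ : Type*} [Field K]
    [LinearOrderedCommGroupWithZero Γ] {v : Valuation K Γ} (h : PadicLike p v)

include h

theorem map_p_ne_zero : v (p : K) ≠ 0 := by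
  have := h.charZero
  rw [v.ne_zero_iff]
  exact_mod_cast (Fact.out : p.Prime).ne_zero

theorem map_p_pos : 0 < v (p : K) := zero_lt_iff.2 h.map_p_ne_zero

theorem pow_le_pow {m n : ℕ} (hmn : m ≤ n) : v (p : K) ^ n ≤ v (p : K) ^ m :=
  pow_le_pow_of_le_one zero_le h.lt_one.le hmn

theorem le_pow_of_ne {x : K} (hx : v x < 1) (hne : ∀ k : ℕ, v x ≠ v (p : K) ^ k) (N : ℕ) :
    v x ≤ v (p : K) ^ N := by
  have hlt : ∀ N : ℕ, v x < v (p : K) ^ N := by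
    intro N
    induction N with
    | zero => simpa using hx
    | succ N ih =>
      refine lt_of_le_of_ne ?_ (hne _)
      have hp := h.map_p_ne_zero
      have h1 : v (x / (p : K) ^ N) < 1 := by
        rw [map_div₀, map_pow]
        exact (div_lt_one₀ (pow_pos h.map_p_pos _)).2 ih
      have h2 := h.le_of_lt_one _ h1
      rw [map_div₀, map_pow, div_le_iff₀ (pow_pos h.map_p_pos _)] at h2
      rwa [pow_succ']
  exact (hlt N).le

/-- A relative version of `exists_one_add_eq_pow`. -/
theorem exists_eq_mul_pow (n : ℕ) (hn : n ≠ 0) : ∃ N : ℕ, 1 ≤ N ∧ ∀ x y : K, y ≠ 0 →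
    v (x - y) ≤ v (p : K) ^ N * v y → ∃ w, w ≠ 0 ∧ x = y * w ^ n := by
  obtain ⟨N, hN⟩ := h.exists_one_add_eq_pow n hn
  refine ⟨N + 1, by omega, fun x y hy hxy => ?_⟩
  have hv : 0 < v y := zero_lt_iff.2 (v.ne_zero_iff.2 hy)
  have h1 : v ((x - y) / y) ≤ v (p : K) ^ (N + 1) := by
    rw [map_div₀]
    exact (div_le_iff₀ hv).2 hxy
  obtain ⟨w, hw⟩ := hN _ (h1.trans (h.pow_le_pow (by omega)))
  refine ⟨w, ?_, ?_⟩
  · rintro rfl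
    rw [zero_pow hn] at hw
    have h3 : (x - y) / y = -1 := by linear_combination hw
    rw [h3, Valuation.map_neg, map_one] at h1
    have h4 : v (p : K) ^ (N + 1) < 1 := pow_lt_one₀ zero_le h.lt_one (by omega)
    exact absurd h1 (not_le.2 h4)
  · rw [← hw]
    field_simp
    ring

theorem eq_of_eval_eq_zero {P : K[X]} (h1 : P.coeff 1 = 1)
    (h2 : ∀ j, 2 ≤ j → v (P.coeff j) < 1) {y y' : K} (hy : v y ≤ 1) (hy' : v y' ≤ 1)
    (hP : P.eval y = 0) (hP' : P.eval y' = 0) : y = y' := by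
  by_contra hne
  have hd : 0 < v (y - y') := zero_lt_iff.2 (v.ne_zero_iff.2 (sub_ne_zero.2 hne))
  have hterm : ∀ j, v (y ^ j - y' ^ j) ≤ v (y - y') := by
    intro j
    rw [← (Commute.all y y').mul_geom_sum₂ j, map_mul]
    refine mul_le_of_le_one_right' (v.map_sum_le fun k _ => ?_)
    simp only [map_mul, map_pow]
    exact mul_le_one' (pow_le_one' hy _) (pow_le_one' hy' _)
  have hp : P = C (P.coeff 0) + X + (P - C (P.coeff 0) - X) := by ring
  set Q := P - C (P.coeff 0) - X with hQ
  have hQc : ∀ j, v (Q.coeff j) ≤ v (p : K) := by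
    intro j
    rcases j with _ | _ | j
    · simp [hQ]
    · simp [hQ, coeff_X, h1]
    · have : Q.coeff (j + 2) = P.coeff (j + 2) := by simp [hQ, coeff_X]
      rw [show j + 1 + 1 = j + 2 by ring, this]
      exact h.le_of_lt_one _ (h2 _ (by omega))
  have h3 : Q.eval y - Q.eval y' = -(y - y') := by
    have e1 : P.eval y = P.coeff 0 + y + Q.eval y := by
      conv_lhs => rw [hp]
      simp
    have e2 : P.eval y' = P.coeff 0 + y' + Q.eval y' := by
      conv_lhs => rw [hp]
      simp
    linear_combination (-1) * hP' + hP - e1 + e2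
  have h4 : v (Q.eval y - Q.eval y') ≤ v (p : K) * v (y - y') := by
    rw [eval_eq_sum_range, eval_eq_sum_range, ← Finset.sum_sub_distrib]
    refine v.map_sum_le fun j _ => ?_
    rw [← mul_sub, map_mul]
    exact mul_le_mul' (hQc j) (hterm j)
  rw [h3, Valuation.map_neg] at h4
  exact absurd h4 (not_le.2 (mul_lt_of_lt_one_left hd h.lt_one))

end PadicLike

/-- Two embeddings of a field identify the classes of its elements modulo powers. -/
def PowCompat {F K₁ K₂ : Type*} [Field F] [Field K₁] [Field K₂] (i₁ : F →+* K₁)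
    (i₂ : F →+* K₂) : Prop :=
  ∀ a, a ≠ 0 → ∀ n, n ≠ 0 → SamePowClass n (i₁ a) (i₂ a)

/-- A pair of elements such that adjoining it to a pair of embeddings preserves `PowCompat`. -/
def IsAdjoinable {F K₁ K₂ : Type*} [Field F] [Field K₁] [Field K₂] (i₁ : F →+* K₁)
    (i₂ : F →+* K₂) (z₁ : K₁) (z₂ : K₂) : Prop :=
  ∀ g : F[X], (g.eval₂ i₁ z₁ = 0 ∧ g.eval₂ i₂ z₂ = 0) ∨
    ∀ n, n ≠ 0 → SamePowClass n (g.eval₂ i₁ z₁) (g.eval₂ i₂ z₂)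

section Monomial

variable {p : ℕ} [Fact p.Prime] {F K Γ : Type*} [Field F] [Field K]
    [LinearOrderedCommGroupWithZero Γ] {v : Valuation K Γ}

theorem PadicLike.exists_dominant_term (h : PadicLike p v) (i : F →+* K) {r : K} (hr : r ≠ 0)
    {D : ℕ} (hD : ∀ k, 0 < k → k < D → ∀ c, v r ^ k ≠ v (i c)) {g : F[X]} (hg : g ≠ 0)
    (hdeg : g.natDegree < D) :
    ∃ j, j < D ∧ g.coeff j ≠ 0 ∧ ∀ k, k ≠ j → ∀ N : ℕ,
      v (i (g.coeff k) * r ^ k) ≤ v (p : K) ^ N * v (i (g.coeff j) * r ^ j) := by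
  obtain ⟨j, hj, hmax⟩ := Finset.exists_max_image g.support
    (fun k => v (i (g.coeff k) * r ^ k)) (by simpa using hg)
  have hgj : g.coeff j ≠ 0 := mem_support_iff.1 hj
  have hjD : j < D := (le_natDegree_of_ne_zero hgj).trans_lt hdeg
  refine ⟨j, hjD, hgj, fun k hk N => ?_⟩
  rcases eq_or_ne (g.coeff k) 0 with h0 | hgk
  · simp [h0]
  have hkD : k < D := (le_natDegree_of_ne_zero hgk).trans_lt hdeg
  have hchar := h.charZero
  have hF : CharZero F := ⟨fun a b hab => by
    have : ((a : ℕ) : K) = b := by rw [← map_natCast i, ← map_natCast i, hab]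
    exact_mod_cast this⟩
  have hp : (p : F) ≠ 0 := by exact_mod_cast (Fact.out : p.Prime).ne_zero
  have hvr : v r ≠ 0 := v.ne_zero_iff.2 hr
  have hvj : v (i (g.coeff j)) ≠ 0 := v.ne_zero_iff.2 ((map_ne_zero i).2 hgj)
  have hvk : v (i (g.coeff k)) ≠ 0 := v.ne_zero_iff.2 ((map_ne_zero i).2 hgk)
  have hy0 : v (i (g.coeff j) * r ^ j) ≠ 0 := by
    rw [map_mul, map_pow]
    exact mul_ne_zero hvj (pow_ne_zero _ hvr)
  have hne : ∀ m : ℕ, v (i (g.coeff k) * r ^ k / (i (g.coeff j) * r ^ j)) ≠ v (p : K) ^ m := by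
    intro m hm
    rw [map_div₀, div_eq_iff hy0] at hm
    simp only [map_mul, map_pow] at hm
    have hpm := h.map_p_ne_zero
    rcases lt_or_gt_of_ne hk with hlt | hlt
    · apply hD (j - k) (by omega) (by omega) (g.coeff k / (p ^ m * g.coeff j))
      simp only [map_div₀, map_mul, map_pow, map_natCast]
      rw [eq_div_iff (mul_ne_zero (pow_ne_zero _ hpm) hvj)]
      apply mul_right_cancel₀ (pow_ne_zero k hvr)
      have hexp : v r ^ j = v r ^ (j - k) * v r ^ k := by rw [← pow_add, Nat.sub_add_cancel hlt.le]
      rw [hm, hexp]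
      ac_rfl
    · apply hD (k - j) (by omega) (by omega) (p ^ m * g.coeff j / g.coeff k)
      simp only [map_div₀, map_mul, map_pow, map_natCast]
      rw [eq_div_iff hvk]
      apply mul_right_cancel₀ (pow_ne_zero j hvr)
      rw [mul_assoc (v (p : K) ^ m), ← hm]
      have hexp : v r ^ k = v r ^ (k - j) * v r ^ j := by rw [← pow_add, Nat.sub_add_cancel hlt.le]
      rw [hexp]
      ac_rfl
  have hle : v (i (g.coeff k) * r ^ k / (i (g.coeff j) * r ^ j)) < 1 := by
    refine lt_of_le_of_ne ?_ (by simpa using hne 0)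
    rw [map_div₀]
    exact (div_le_one₀ (zero_lt_iff.2 hy0)).2 (hmax k (mem_support_iff.2 hgk))
  have := h.le_pow_of_ne hle hne N
  rwa [map_div₀, div_le_iff₀ (zero_lt_iff.2 hy0)] at this

end Monomial

section Compat

variable {p : ℕ} [Fact p.Prime] {F K₁ K₂ Γ₁ Γ₂ : Type*} [Field F] [Field K₁] [Field K₂]
    [LinearOrderedCommGroupWithZero Γ₁] [LinearOrderedCommGroupWithZero Γ₂]
    {v₁ : Valuation K₁ Γ₁} {v₂ : Valuation K₂ Γ₂}

theorem SamePowClass.isPow_iff (h₁ : PadicLike p v₁) (h₂ : PadicLike p v₂) {n : ℕ} (hn : n ≠ 0)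
    {a : K₁} {b : K₂} (h : SamePowClass n a b) : (∃ w, a = w ^ n) ↔ ∃ w, b = w ^ n := by
  obtain ⟨q, hq, s, t, hs, ht, rfl, rfl⟩ := h
  have e1 : (∃ w, (q : K₁) * s ^ n = w ^ n) ↔ ∃ w, (q : K₁) = w ^ n :=
    ⟨fun ⟨w, hw⟩ => ⟨w / s, by rw [div_pow, ← hw]; field_simp⟩,
      fun ⟨w, hw⟩ => ⟨w * s, by rw [mul_pow, ← hw]⟩⟩
  have e2 : (∃ w, (q : K₂) * t ^ n = w ^ n) ↔ ∃ w, (q : K₂) = w ^ n :=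
    ⟨fun ⟨w, hw⟩ => ⟨w / t, by rw [div_pow, ← hw]; field_simp⟩,
      fun ⟨w, hw⟩ => ⟨w * t, by rw [mul_pow, ← hw]⟩⟩
  rw [e1, e2, h₁.natCast_eq_pow_iff n q hn, h₂.natCast_eq_pow_iff n q hn]

variable {i₁ : F →+* K₁} {i₂ : F →+* K₂}

theorem PowCompat.le_one_iff (hc : PowCompat i₁ i₂) (h₁ : PadicLike p v₁) (h₂ : PadicLike p v₂)
    (a : F) : v₁ (i₁ a) ≤ 1 ↔ v₂ (i₂ a) ≤ 1 := by
  rw [h₁.le_one_iff, h₂.le_one_iff]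
  have e1 : 1 + p * i₁ a ^ (p + 1) = i₁ (1 + p * a ^ (p + 1)) := by simp
  have e2 : 1 + p * i₂ a ^ (p + 1) = i₂ (1 + p * a ^ (p + 1)) := by simp
  rw [e1, e2]
  rcases eq_or_ne (1 + p * a ^ (p + 1)) 0 with h0 | h0
  · rw [h0]
    exact iff_of_true ⟨0, by simp⟩ ⟨0, by simp⟩
  · simpa only [eq_comm] using (hc _ h0 (p + 1) (by omega)).isPow_iff h₁ h₂ (by omega)

theorem PowCompat.le_iff (hc : PowCompat i₁ i₂) (h₁ : PadicLike p v₁) (h₂ : PadicLike p v₂)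
    (a b : F) : v₁ (i₁ a) ≤ v₁ (i₁ b) ↔ v₂ (i₂ a) ≤ v₂ (i₂ b) := by
  rcases eq_or_ne b 0 with rfl | hb
  · simp
  have := hc.le_one_iff h₁ h₂ (a / b)
  have hb1 : 0 < v₁ (i₁ b) := zero_lt_iff.2 (v₁.ne_zero_iff.2 ((map_ne_zero i₁).2 hb))
  have hb2 : 0 < v₂ (i₂ b) := zero_lt_iff.2 (v₂.ne_zero_iff.2 ((map_ne_zero i₂).2 hb))
  rwa [map_div₀, map_div₀, map_div₀, map_div₀, div_le_one₀ hb1, div_le_one₀ hb2] at this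

theorem PowCompat.lt_iff (hc : PowCompat i₁ i₂) (h₁ : PadicLike p v₁) (h₂ : PadicLike p v₂)
    (a b : F) : v₁ (i₁ a) < v₁ (i₁ b) ↔ v₂ (i₂ a) < v₂ (i₂ b) := by
  simpa only [not_le] using (hc.le_iff h₁ h₂ b a).not

/-- An `n`-th root in `K₁` of an element of `F` has a counterpart in `K₂`. -/
theorem PowCompat.exists_root (hc : PowCompat i₁ i₂) (h₁ : PadicLike p v₁) (h₂ : PadicLike p v₂)
    {n : ℕ} (hn : n ≠ 0) {r : K₁} {c : F} (hr : r ^ n = i₁ c) (hc0 : c ≠ 0) :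
    ∃ r' : K₂, r' ^ n = i₂ c ∧ ∀ m, m ≠ 0 → SamePowClass m r r' := by
  have hchar1 := h₁.charZero
  have hchar2 := h₂.charZero
  have hr0 : r ≠ 0 := by
    rintro rfl
    rw [zero_pow hn, eq_comm, map_eq_zero] at hr
    exact hc0 hr
  have key : ∀ m, m ≠ 0 → ∃ r' : K₂, r' ^ n = i₂ c ∧ SamePowClass m r r' := by
    intro m hm
    obtain ⟨q, hq, s, hs⟩ := h₁.exists_eq m hm r hr0
    have hs0 : s ≠ 0 := by
      rintro rfl
      rw [zero_pow hm, mul_zero] at hs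
      exact hr0 hs
    have hL : m * n ≠ 0 := mul_ne_zero hm hn
    obtain ⟨q1, hq1, s1, t1, hs1, ht1, e1, e2⟩ := hc c hc0 (m * n) hL
    have hqK : (q : K₁) ≠ 0 := by exact_mod_cast hq
    have hq1K : (q1 : K₁) ≠ 0 := by exact_mod_cast hq1
    have hq1K2 : (q1 : K₂) ≠ 0 := by exact_mod_cast hq1
    have e3 : (q : K₁) ^ n * s ^ (m * n) = q1 * s1 ^ (m * n) := by
      rw [← e1, ← hr, hs, mul_pow, pow_mul]
    obtain ⟨L, hL'⟩ := Nat.exists_eq_succ_of_ne_zero hL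
    have e4 : ∃ w : K₁, ((q ^ n * q1 ^ L : ℕ) : K₁) = w ^ (m * n) := by
      refine ⟨q1 * s1 / s, ?_⟩
      rw [div_pow, eq_div_iff (pow_ne_zero _ hs0), mul_pow]
      push_cast
      have : (q1 : K₁) ^ (m * n) = q1 ^ L * q1 := by rw [hL', pow_succ]
      rw [this]
      linear_combination (q1 : K₁) ^ L * e3
    rw [h₁.natCast_eq_pow_iff _ _ hL, ← h₂.natCast_eq_pow_iff _ _ hL] at e4
    obtain ⟨w, hw⟩ := e4
    have hw0 : w ≠ 0 := by
      rintro rfl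
      rw [zero_pow hL, Nat.cast_eq_zero] at hw
      exact mul_ne_zero (pow_ne_zero _ hq) (pow_ne_zero _ hq1) hw
    refine ⟨q * (t1 * q1 / w) ^ m, ?_, q, hq, s, _, hs0, ?_, hs, rfl⟩
    · rw [mul_pow, ← pow_mul, e2, div_pow, ← hw, mul_pow]
      push_cast
      have : (q1 : K₂) ^ (m * n) = q1 ^ L * q1 := by rw [hL', pow_succ]
      have hqK2 : (q : K₂) ≠ 0 := by exact_mod_cast hq
      rw [this]
      field_simp
    · exact div_ne_zero (mul_ne_zero ht1 hq1K2) hw0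
  choose! f hf1 hf2 using key
  have hfin : {y : K₂ | y ^ n = i₂ c}.Finite := by
    have hP : (X ^ n - C (i₂ c) : K₂[X]) ≠ 0 := X_pow_sub_C_ne_zero (Nat.pos_of_ne_zero hn) _
    refine (Multiset.finite_toSet (X ^ n - C (i₂ c) : K₂[X]).roots).subset fun y hy => ?_
    rw [Set.mem_ofPred_eq] at hy
    simp [mem_roots hP, IsRoot, hy]
  have : Finite {y : K₂ | y ^ n = i₂ c} := hfin
  obtain ⟨y, hy⟩ := Finite.exists_infinite_fiber
    (fun m : ℕ => (⟨f (m + 1).factorial, hf1 _ (Nat.factorial_ne_zero _)⟩ :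
      {y : K₂ | y ^ n = i₂ c}))
  refine ⟨y, y.2, fun m hm => ?_⟩
  obtain ⟨M, hM, hmM⟩ := (Set.infinite_coe_iff.1 hy).exists_gt m
  have e := congrArg Subtype.val (Set.mem_singleton_iff.1 (Set.mem_preimage.1 hM))
  simp only at e
  rw [← e]
  exact (hf2 _ (Nat.factorial_ne_zero (M + 1))).of_dvd
    (Nat.dvd_factorial (Nat.pos_of_ne_zero hm) (by omega)) (Nat.factorial_ne_zero _)

end Compat

section Core

variable {p : ℕ} [Fact p.Prime] {F K₁ K₂ Γ₁ Γ₂ : Type*} [Field F] [Field K₁] [Field K₂]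
    [LinearOrderedCommGroupWithZero Γ₁] [LinearOrderedCommGroupWithZero Γ₂]
    {v₁ : Valuation K₁ Γ₁} {v₂ : Valuation K₂ Γ₂} {i₁ : F →+* K₁} {i₂ : F →+* K₂}

theorem SamePowClass.pow {n : ℕ} {a : K₁} {b : K₂} (h : SamePowClass n a b) (k : ℕ) :
    SamePowClass n (a ^ k) (b ^ k) := by
  obtain ⟨q, hq, s, t, hs, ht, rfl, rfl⟩ := h
  exact ⟨q ^ k, pow_ne_zero _ hq, s ^ k, t ^ k, pow_ne_zero _ hs, pow_ne_zero _ ht,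
    by push_cast; ring, by push_cast; ring⟩

theorem PadicLike.exists_samePowClass_of_close (h₁ : PadicLike p v₁) (h₂ : PadicLike p v₂) (m : ℕ)
    (hm : m ≠ 0) : ∃ N : ℕ, 1 ≤ N ∧ ∀ (x y : K₁) (x' y' : K₂), SamePowClass m y y' →
      v₁ (x - y) ≤ v₁ (p : K₁) ^ N * v₁ y → v₂ (x' - y') ≤ v₂ (p : K₂) ^ N * v₂ y' →
      SamePowClass m x x' := by
  have := h₁.charZero
  have := h₂.charZero
  obtain ⟨N₁, hN₁, H₁⟩ := h₁.exists_eq_mul_pow m hm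
  obtain ⟨N₂, hN₂, H₂⟩ := h₂.exists_eq_mul_pow m hm
  refine ⟨max N₁ N₂, hN₁.trans (le_max_left _ _), fun x y x' y' h e₁ e₂ => ?_⟩
  obtain ⟨w, hw, rfl⟩ := H₁ x y h.left_ne_zero
    (e₁.trans (mul_le_mul_left (h₁.pow_le_pow (le_max_left _ _)) _))
  obtain ⟨w', hw', rfl⟩ := H₂ x' y' h.right_ne_zero
    (e₂.trans (mul_le_mul_left (h₂.pow_le_pow (le_max_right _ _)) _))
  exact h.mul (samePowClass_pow hw hw')

/-- If no nontrivial extension of `i₁, i₂` exists, the value group of `F` is pure in that of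
`K₁`. -/
theorem PowCompat.exists_map_eq_of_pow (hc : PowCompat i₁ i₂) (h₁ : PadicLike p v₁)
    (h₂ : PadicLike p v₂) (hmax : ∀ z z', IsAdjoinable i₁ i₂ z z' → ∃ a, i₁ a = z) {s : K₁}
    (hs : s ≠ 0) {n : ℕ} (hn : n ≠ 0) {c : F} (hsc : v₁ s ^ n = v₁ (i₁ c)) :
    ∃ d, v₁ s = v₁ (i₁ d) := by
  classical
  have hchar := h₁.charZero
  have hex : ∃ n, n ≠ 0 ∧ ∃ c, v₁ s ^ n = v₁ (i₁ c) := ⟨n, hn, c, hsc⟩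
  clear hsc hn c n
  obtain ⟨hn, c, hsc⟩ := Nat.find_spec hex
  have hmin := fun k (hk : k < Nat.find hex) => Nat.find_min hex hk
  set n := Nat.find hex
  have hvs : v₁ s ≠ 0 := v₁.ne_zero_iff.2 hs
  have hc0 : c ≠ 0 := by
    rintro rfl
    rw [map_zero, map_zero] at hsc
    exact pow_ne_zero n hvs hsc
  have hic : i₁ c ≠ 0 := (map_ne_zero i₁).2 hc0
  obtain ⟨q, hq, w, hw, hsw⟩ := h₁.exists_unit_eq n hn (s ^ n / i₁ c) (by
    rw [map_div₀, map_pow, hsc, div_self (v₁.ne_zero_iff.2 hic)])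
  have hw0 : w ≠ 0 := by
    rintro rfl
    simp at hw
  have hF : CharZero F := ⟨fun a b hab => by
    have : ((a : ℕ) : K₁) = b := by rw [← map_natCast i₁, ← map_natCast i₁, hab]
    exact_mod_cast this⟩
  have hcq : c * q ≠ 0 := mul_ne_zero hc0 (by exact_mod_cast hq)
  have hr : (s / w) ^ n = i₁ (c * q) := by
    rw [div_pow, map_mul, map_natCast, div_eq_iff (pow_ne_zero _ hw0), mul_assoc, ← hsw]
    field_simp
  have hvr : v₁ (s / w) = v₁ s := by rw [map_div₀, hw, div_one]
  set r := s / w with hr_def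
  have hr0 : r ≠ 0 := div_ne_zero hs hw0
  obtain ⟨r', hr', hrr⟩ := hc.exists_root h₁ h₂ hn hr hcq
  have hr'0 : r' ≠ 0 := by
    rintro rfl
    rw [zero_pow hn, eq_comm, map_eq_zero] at hr'
    exact hcq hr'
  obtain ⟨a, ha⟩ := hmax r r' <| by
    intro g
    have hmon : (X ^ n - C (c * (q : F))).Monic := monic_X_pow_sub_C _ hn
    have hdeg : (g %ₘ (X ^ n - C (c * (q : F)))).natDegree < n := by
      have := natDegree_modByMonic_lt g hmon (fun h => by
        have h2 := natDegree_X_pow_sub_C (n := n) (r := c * (q : F))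
        rw [h, natDegree_one] at h2
        exact hn h2.symm)
      rwa [natDegree_X_pow_sub_C] at this
    have hg1 : g.eval₂ i₁ r = (g %ₘ (X ^ n - C (c * (q : F)))).eval₂ i₁ r := by
      conv_lhs => rw [← modByMonic_add_div g (X ^ n - C (c * (q : F)))]
      simp [eval₂_mul, eval₂_add, eval₂_sub, hr]
    have hg2 : g.eval₂ i₂ r' = (g %ₘ (X ^ n - C (c * (q : F)))).eval₂ i₂ r' := by
      conv_lhs => rw [← modByMonic_add_div g (X ^ n - C (c * (q : F)))]
      simp [eval₂_mul, eval₂_add, eval₂_sub, hr']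
    rw [hg1, hg2]
    generalize g %ₘ (X ^ n - C (c * (q : F))) = g₀ at hdeg
    rcases eq_or_ne g₀ 0 with rfl | hg0
    · left; simp
    right
    intro m hm
    obtain ⟨j, hjn, hgj, hdom⟩ := h₁.exists_dominant_term i₁ hr0 (fun k hk hkn d hd =>
      hmin k hkn ⟨hk.ne', d, by rw [← hvr]; exact hd⟩) hg0 hdeg
    have hdom2 : ∀ k, k ≠ j → ∀ N : ℕ,
        v₂ (i₂ (g₀.coeff k) * r' ^ k) ≤ v₂ (p : K₂) ^ N * v₂ (i₂ (g₀.coeff j) * r' ^ j) := by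
      intro k hk N
      have e := pow_le_pow_left₀ zero_le (hdom k hk N) n
      have e1 : (v₁ (i₁ (g₀.coeff k) * r ^ k)) ^ n =
          v₁ (i₁ (g₀.coeff k ^ n * (c * q) ^ k)) := by
        rw [← map_pow, mul_pow, ← pow_mul, mul_comm k, pow_mul, hr]; simp
      have e2 : (v₁ (p : K₁) ^ N * v₁ (i₁ (g₀.coeff j) * r ^ j)) ^ n =
          v₁ (i₁ (p ^ (N * n) * (g₀.coeff j ^ n * (c * q) ^ j))) := by
        rw [mul_pow, ← map_pow v₁ (_ * _), mul_pow (i₁ _), ← pow_mul r, mul_comm j, pow_mul r, hr]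
        simp [pow_mul]
      have e1' : (v₂ (i₂ (g₀.coeff k) * r' ^ k)) ^ n =
          v₂ (i₂ (g₀.coeff k ^ n * (c * q) ^ k)) := by
        rw [← map_pow, mul_pow, ← pow_mul, mul_comm k, pow_mul, hr']; simp
      have e2' : (v₂ (p : K₂) ^ N * v₂ (i₂ (g₀.coeff j) * r' ^ j)) ^ n =
          v₂ (i₂ (p ^ (N * n) * (g₀.coeff j ^ n * (c * q) ^ j))) := by
        rw [mul_pow, ← map_pow v₂ (_ * _), mul_pow (i₂ _), ← pow_mul r', mul_comm j, pow_mul r',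
          hr']
        simp [pow_mul]
      rw [e1, e2, hc.le_iff h₁ h₂, ← e1', ← e2'] at e
      exact (pow_le_pow_iff_left₀ zero_le zero_le hn).1 e
    obtain ⟨N, -, H⟩ := h₁.exists_samePowClass_of_close h₂ m hm
    refine H _ (i₁ (g₀.coeff j) * r ^ j) _ (i₂ (g₀.coeff j) * r' ^ j)
      ((hc _ hgj m hm).mul ((hrr m hm).pow j)) ?_ ?_
    · exact v₁.eval₂_sub_term_le i₁ fun k hk => hdom k hk N
    · exact v₂.eval₂_sub_term_le i₂ fun k hk => hdom2 k hk N
  exact ⟨a, by rw [ha, hvr]⟩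

/-- Every polynomial over `F` takes at `z` a value in the class of its values along `𝓕`. -/
def Approximates (i : F →+* K₁) (z : K₁) (𝓕 : Filter F) : Prop :=
  ∀ g : F[X], g ≠ 0 → ∀ M : ℕ, M ≠ 0 → ∀ᶠ y in 𝓕, g.eval y ≠ 0 ∧
    ∃ w, w ≠ 0 ∧ g.eval₂ i z = i (g.eval y) * w ^ M

section Cut

variable {v : Valuation K₁ Γ₁} {i : F →+* K₁} (h : PadicLike p v)
  (hpure : ∀ s : K₁, s ≠ 0 → ∀ n : ℕ, n ≠ 0 → ∀ c, v s ^ n = v (i c) → ∃ d, v s = v (i d))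

include h hpure

theorem exists_upper_cut [CharZero F] {z : K₁} {e : ℕ} (he : e ≠ 0) {b : F}
    (hb : v z ^ e < v (i b)) (N : ℕ) :
    ∃ d, v z < v (i d) ∧ ∃ N', ∀ y, v y ≤ v (p : K₁) ^ N' * v (i d) →
      v y ^ e ≤ v (p : K₁) ^ N * v (i b) := by
  have hchar := h.charZero
  have hb0 : i b ≠ 0 := v.ne_zero_iff.1 (zero_le.trans_lt hb).ne'
  obtain ⟨q, hq, s, hs⟩ := h.exists_eq e he (i b) hb0
  have hs0 : s ≠ 0 := by
    rintro rfl
    rw [zero_pow he, mul_zero] at hs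
    exact hb0 hs
  have hqK : (q : K₁) ≠ 0 := by exact_mod_cast hq
  obtain ⟨d, hd⟩ := hpure s hs0 e he (b / q) (by
    rw [← map_pow, map_div₀, map_natCast, hs, mul_div_cancel_left₀ _ hqK])
  obtain ⟨C, hC⟩ := h.exists_pow_le_natCast q hq
  have hvb : v (i b) = v (q : K₁) * v (i d) ^ e := by rw [hs, map_mul, map_pow, hd]
  refine ⟨d, ?_, N + C, fun y hy => ?_⟩
  · refine lt_of_pow_lt_pow_left₀ e zero_le (hb.trans_le ?_)
    rw [hvb]
    exact mul_le_of_le_one_left' (v.map_natCast_le_one' q)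
  · calc v y ^ e ≤ (v (p : K₁) ^ (N + C) * v (i d)) ^ e := pow_le_pow_left₀ zero_le hy e
      _ = v (p : K₁) ^ ((N + C) * e) * v (i d) ^ e := by rw [mul_pow, pow_mul]
      _ ≤ v (p : K₁) ^ (N + C) * v (i d) ^ e := by
          gcongr ?_ * _
          exact h.pow_le_pow (Nat.le_mul_of_pos_right _ (Nat.pos_of_ne_zero he))
      _ ≤ _ := by
          rw [hvb, pow_add, mul_assoc]
          gcongr

theorem exists_lower_cut [CharZero F] {z : K₁} {e : ℕ} (he : e ≠ 0)
    (hz : ∀ c, v z ≠ v (i c)) {b : F} (hb0 : b ≠ 0)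
    (hb : ∀ N : ℕ, v (i b) ≤ v (p : K₁) ^ N * v z ^ e) :
    ∃ d, v (i d) < v z ∧ ∀ (N : ℕ) (y : K₁), v (i d) ≤ v (p : K₁) ^ N * v y →
      v (i b) ≤ v (p : K₁) ^ N * v y ^ e := by
  have hchar := h.charZero
  have hb0 : i b ≠ 0 := (map_ne_zero i).2 hb0
  obtain ⟨q, hq, s, hs⟩ := h.exists_eq e he (i b) hb0
  have hs0 : s ≠ 0 := by
    rintro rfl
    rw [zero_pow he, mul_zero] at hs
    exact hb0 hs
  have hqK : (q : K₁) ≠ 0 := by exact_mod_cast hq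
  obtain ⟨d, hd⟩ := hpure s hs0 e he (b / q) (by
    rw [← map_pow, map_div₀, map_natCast, hs, mul_div_cancel_left₀ _ hqK])
  obtain ⟨C, hC⟩ := h.exists_pow_le_natCast q hq
  have hvb : v (i b) = v (q : K₁) * v (i d) ^ e := by rw [hs, map_mul, map_pow, hd]
  refine ⟨d, lt_of_le_of_ne ?_ (hz d).symm, fun N y hy => ?_⟩
  · have h1 := hb C
    rw [hvb] at h1
    have h2 : v (q : K₁) * v (i d) ^ e ≤ v (q : K₁) * v z ^ e :=
      h1.trans (by gcongr)
    exact (pow_le_pow_iff_left₀ zero_le zero_le he).1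
      ((mul_le_mul_iff_right₀ (zero_lt_iff.2 (v.ne_zero_iff.2 hqK))).1 h2)
  · calc v (i b) ≤ v (i d) ^ e := by
          rw [hvb]
          exact mul_le_of_le_one_left' (v.map_natCast_le_one' q)
      _ ≤ (v (p : K₁) ^ N * v y) ^ e := pow_le_pow_left₀ zero_le hy e
      _ = v (p : K₁) ^ (N * e) * v y ^ e := by rw [mul_pow, pow_mul]
      _ ≤ _ := by
          gcongr ?_ * _
          exact h.pow_le_pow (Nat.le_mul_of_pos_right _ (Nat.pos_of_ne_zero he))

/-- An element of new value which is less than one is approximated by elements of `F`. -/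
theorem exists_approximates_of_map_ne {z : K₁} (hz : ∀ c, v z ≠ v (i c)) (hz1 : v z < 1) :
    ∃ 𝓕 : Filter F, 𝓕.NeBot ∧ Approximates i z 𝓕 := by
  have hchar := h.charZero
  have hF : CharZero F := ⟨fun a b hab => by
    have : ((a : ℕ) : K₁) = b := by rw [← map_natCast i, ← map_natCast i, hab]
    exact_mod_cast this⟩
  have hz0 : z ≠ 0 := by
    rintro rfl
    exact hz 0 (by simp)
  have hvz : v z ≠ 0 := v.ne_zero_iff.2 hz0
  have hzk : ∀ k, 0 < k → ∀ c, v z ^ k ≠ v (i c) := by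
    intro k hk c hkc
    obtain ⟨d, hd⟩ := hpure z hz0 k hk.ne' c hkc
    exact hz d hd
  let S : {d // v z < v (i d)} × {d // v (i d) < v z} × ℕ → Set F := fun t =>
    {y | v (i y) ≤ v (p : K₁) ^ t.2.2 * v (i t.1) ∧ v (i t.2.1) ≤ v (p : K₁) ^ t.2.2 * v (i y) ∧
      y ≠ 0 ∧ ∃ w, w ≠ 0 ∧ z = i y * w ^ t.2.2.factorial}
  have hmono : ∀ t t' : {d // v z < v (i d)} × {d // v (i d) < v z} × ℕ,
      v (i t.1) ≤ v (i t'.1) → v (i t'.2.1) ≤ v (i t.2.1) → t'.2.2 ≤ t.2.2 → S t ⊆ S t' := by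
    rintro t t' e1 e2 e3 y ⟨f1, f2, f3, w, hw, f4⟩
    refine ⟨f1.trans (mul_le_mul' (h.pow_le_pow e3) e1),
      e2.trans (f2.trans (mul_le_mul' (h.pow_le_pow e3) le_rfl)), f3, ?_⟩
    obtain ⟨k, hk⟩ := Nat.factorial_dvd_factorial e3
    exact ⟨w ^ k, pow_ne_zero _ hw, by
      refine f4.trans ?_
      rw [hk, ← pow_mul, mul_comm k]⟩
  let 𝓕 : Filter F := ⨅ t, 𝓟 (S t)
  have hmem : ∀ t, S t ∈ 𝓕 := fun t => mem_iInf_of_mem t (mem_principal_self _)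
  have h1 : v z < v (i 1) := by simpa using hz1
  have h0 : v (i 0) < v z := by simpa using zero_lt_iff.2 hvz
  refine ⟨𝓕, ?_, ?_⟩
  · have : Nonempty ({d // v z < v (i d)} × {d // v (i d) < v z} × ℕ) :=
      ⟨⟨1, h1⟩, ⟨0, h0⟩, 0⟩
    refine iInf_neBot_of_directed' ?_ ?_
    · rintro ⟨t1, t2, t3⟩ ⟨t1', t2', t3'⟩
      obtain ⟨a, ha, ha'⟩ : ∃ a : {d // v z < v (i d)},
          v (i a) ≤ v (i t1) ∧ v (i a) ≤ v (i t1') := by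
        rcases le_total (v (i t1)) (v (i t1')) with e | e
        exacts [⟨t1, le_rfl, e⟩, ⟨t1', e, le_rfl⟩]
      obtain ⟨b, hb, hb'⟩ : ∃ b : {d // v (i d) < v z},
          v (i t2) ≤ v (i b) ∧ v (i t2') ≤ v (i b) := by
        rcases le_total (v (i t2)) (v (i t2')) with e | e
        exacts [⟨t2', e, le_rfl⟩, ⟨t2, le_rfl, e⟩]
      exact ⟨⟨a, b, max t3 t3'⟩,
        principal_mono.2 (hmono ⟨a, b, max t3 t3'⟩ ⟨t1, t2, t3⟩ ha hb (le_max_left _ _)),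
        principal_mono.2 (hmono ⟨a, b, max t3 t3'⟩ ⟨t1', t2', t3'⟩ ha' hb' (le_max_right _ _))⟩
    · rintro ⟨⟨d, hd⟩, ⟨d', hd'⟩, n⟩
      rw [principal_neBot_iff]
      have hd0 : i d ≠ 0 := v.ne_zero_iff.1 (zero_le.trans_lt hd).ne'
      have hvd : 0 < v (i d) := zero_lt_iff.2 (v.ne_zero_iff.2 hd0)
      have hM := Nat.factorial_ne_zero n
      have hp0 : (p : F) ≠ 0 := by exact_mod_cast (Fact.out : p.Prime).ne_zero
      have hp1 : (p : K₁) ≠ 0 := by exact_mod_cast (Fact.out : p.Prime).ne_zero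
      obtain ⟨q, hq, s, hs⟩ := h.exists_eq n.factorial hM (z / i d) (div_ne_zero hz0 hd0)
      have hs0 : s ≠ 0 := by
        rintro rfl
        rw [zero_pow hM, mul_zero] at hs
        exact div_ne_zero hz0 hd0 hs
      obtain ⟨C, hC⟩ := h.exists_pow_le_natCast q hq
      have hq0 : (q : F) ≠ 0 := by exact_mod_cast hq
      have hsmall : ∀ N : ℕ, v z ≤ v (p : K₁) ^ N * v (i d) := by
        intro N
        have := h.le_pow_of_ne (x := z / i d)
          (by rw [map_div₀]; exact (div_lt_one₀ hvd).2 hd) (fun k hk => by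
            rw [map_div₀, div_eq_iff hvd.ne'] at hk
            exact hz (p ^ k * d) (by simpa using hk)) N
        rwa [map_div₀, div_le_iff₀ hvd] at this
      refine ⟨d * (q * (p ^ n) ^ n.factorial), ?_, ?_, ?_, s / p ^ n, ?_, ?_⟩
      · simp only [map_mul, map_pow, map_natCast]
        rw [mul_comm (v (i d)), ← pow_mul]
        gcongr ?_ * _
        refine (mul_le_of_le_one_left' (v.map_natCast_le_one' q)).trans (h.pow_le_pow ?_)
        exact Nat.le_mul_of_pos_right _ (Nat.factorial_pos n)
      · refine hd'.le.trans ((hsmall (n + (C + n * n.factorial))).trans ?_)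
        simp only [map_mul, map_pow, map_natCast]
        rw [mul_comm (v (i d)), ← mul_assoc, pow_add, pow_add, pow_mul]
        gcongr
      · refine mul_ne_zero (fun hh => hd0 (by rw [hh, map_zero])) (mul_ne_zero hq0 ?_)
        exact pow_ne_zero _ (pow_ne_zero _ hp0)
      · exact div_ne_zero hs0 (pow_ne_zero _ hp1)
      · simp only [map_mul, map_pow, map_natCast]
        rw [div_eq_iff hd0] at hs
        rw [hs, div_pow]
        field_simp
  · intro g hg M hM
    obtain ⟨j, -, hgj, hdom⟩ := h.exists_dominant_term i hz0 (D := g.natDegree + 1)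
      (fun k hk _ => hzk k hk) hg (Nat.lt_succ_self _)
    obtain ⟨N, -, hN⟩ := h.exists_eq_mul_pow M hM
    have hvj : v (i (g.coeff j)) ≠ 0 := v.ne_zero_iff.2 ((map_ne_zero i).2 hgj)
    have hev : ∀ k, k ≠ j → ∀ᶠ y in 𝓕,
        v (i (g.coeff k) * i y ^ k) ≤ v (p : K₁) ^ N * v (i (g.coeff j) * i y ^ j) := by
      intro k hk
      rcases eq_or_ne (g.coeff k) 0 with h0' | hgk
      · simp [h0']
      have hvk : v (i (g.coeff k)) ≠ 0 := v.ne_zero_iff.2 ((map_ne_zero i).2 hgk)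
      have hdk := hdom k hk
      simp only [map_mul, map_pow] at hdk ⊢
      rcases lt_or_gt_of_ne hk with hlt | hlt
      · have hexp : ∀ γ : Γ₁, γ ^ j = γ ^ (j - k) * γ ^ k := fun γ => by
          rw [← pow_add, Nat.sub_add_cancel hlt.le]
        obtain ⟨d, hd, H⟩ := exists_lower_cut h hpure (e := j - k) (by omega) hz
          (div_ne_zero hgk hgj) (fun N => by
            rw [map_div₀, map_div₀, div_le_iff₀ (zero_lt_iff.2 hvj)]
            refine (mul_le_mul_iff_left₀ (zero_lt_iff.2 (pow_ne_zero k hvz))).1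
              ((hdk N).trans_eq ?_)
            rw [hexp]
            ac_rfl)
        filter_upwards [hmem ⟨⟨1, h1⟩, ⟨d, hd⟩, N⟩] with y hy
        have := H N (i y) hy.2.1
        rw [map_div₀, map_div₀, div_le_iff₀ (zero_lt_iff.2 hvj)] at this
        refine (mul_le_mul_left this (v (i y) ^ k)).trans_eq ?_
        rw [hexp (v (i y))]
        ac_rfl
      · have hexp : ∀ γ : Γ₁, γ ^ k = γ ^ (k - j) * γ ^ j := fun γ => by
          rw [← pow_add, Nat.sub_add_cancel hlt.le]
        have hb : ∀ N : ℕ, v z ^ (k - j) ≤ v (p : K₁) ^ N * v (i (g.coeff j / g.coeff k)) := by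
          intro N
          rw [map_div₀, map_div₀, ← mul_div_assoc, le_div_iff₀ (zero_lt_iff.2 hvk)]
          refine (mul_le_mul_iff_left₀ (zero_lt_iff.2 (pow_ne_zero j hvz))).1 ?_
          refine le_trans (le_of_eq ?_) ((hdk N).trans_eq ?_)
          · rw [hexp (v z)]
            ac_rfl
          · ac_rfl
        obtain ⟨d, hd, N', H⟩ := exists_upper_cut h hpure (z := z) (e := k - j) (by omega)
          (b := g.coeff j / g.coeff k) (lt_of_le_of_ne (by simpa using hb 0)
            (hzk _ (by omega) _)) N
        filter_upwards [hmem ⟨⟨d, hd⟩, ⟨0, h0⟩, N'⟩] with y hy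
        have := H (i y) hy.1
        rw [map_div₀, map_div₀, ← mul_div_assoc, le_div_iff₀ (zero_lt_iff.2 hvk)] at this
        refine le_trans (le_of_eq ?_) ((mul_le_mul_left this (v (i y) ^ j)).trans_eq ?_)
        · rw [hexp (v (i y))]
          ac_rfl
        · exact mul_assoc _ _ _
    have hev' : ∀ᶠ y in 𝓕, ∀ k ∈ g.support, k ≠ j →
        v (i (g.coeff k) * i y ^ k) ≤ v (p : K₁) ^ N * v (i (g.coeff j) * i y ^ j) := by
      rw [eventually_all_finset]
      intro k _
      by_cases hkj : k = j
      · exact Eventually.of_forall fun y hh => absurd hkj hh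
      · exact (hev k hkj).mono fun y hy _ => hy
    filter_upwards [hev', hmem ⟨⟨1, h1⟩, ⟨0, h0⟩, M⟩] with y hy hy'
    obtain ⟨-, -, hy0, w, hw, hzw⟩ := hy'
    have hy0' : i y ≠ 0 := (map_ne_zero i).2 hy0
    obtain ⟨u, hu, eu⟩ := hN (g.eval₂ i z) (i (g.coeff j) * z ^ j)
      (mul_ne_zero ((map_ne_zero i).2 hgj) (pow_ne_zero _ hz0))
      (v.eval₂_sub_term_le i fun k hk => hdom k hk N)
    obtain ⟨u', hu', eu'⟩ := hN (g.eval₂ i (i y)) (i (g.coeff j) * i y ^ j)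
      (mul_ne_zero ((map_ne_zero i).2 hgj) (pow_ne_zero _ hy0'))
      (v.eval₂_sub_term_le i fun k hk => by
        by_cases hks : k ∈ g.support
        · exact hy k hks hk
        · simp [notMem_support_iff.1 hks])
    rw [eval₂_hom] at eu'
    obtain ⟨L, hL⟩ := Nat.dvd_factorial (Nat.pos_of_ne_zero hM) le_rfl
    refine ⟨fun hh => ?_, (w ^ L) ^ j * u / u', ?_, ?_⟩
    · rw [hh, map_zero, eq_comm] at eu'
      exact mul_ne_zero (mul_ne_zero ((map_ne_zero i).2 hgj) (pow_ne_zero _ hy0'))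
        (pow_ne_zero _ hu') eu'
    · exact div_ne_zero (mul_ne_zero (pow_ne_zero _ (pow_ne_zero _ hw)) hu) hu'
    · rw [eu, eu']
      have : z ^ j = i y ^ j * ((w ^ L) ^ j) ^ M := by
        conv_lhs => rw [hzw]
        simp only at hL ⊢
        rw [hL, mul_pow, ← pow_mul, ← pow_mul, ← pow_mul]
        congr 2
        ring
      rw [this, div_pow, mul_pow]
      field_simp

end Cut

end Core

section Dense

variable {p : ℕ} [Fact p.Prime] {F K₁ K₂ Γ₁ Γ₂ : Type*} [Field F] [Field K₁] [Field K₂]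
    [LinearOrderedCommGroupWithZero Γ₁] [LinearOrderedCommGroupWithZero Γ₂]

theorem Polynomial.coeff_taylor_derivative {R : Type*} [CommRing R] (x : R) (G : R[X]) (j : ℕ) :
    (taylor x (derivative G)).coeff j = (taylor x G).coeff (j + 1) * (j + 1) := by
  have : taylor x (derivative G) = derivative (taylor x G) := by
    rw [taylor_apply, taylor_apply, derivative_comp]
    simp
  rw [this, coeff_derivative]

theorem Polynomial.coeff_taylor_map {R S : Type*} [CommRing R] [CommRing S] (i : R →+* S) (a : R)
    (g : R[X]) (j : ℕ) : (taylor (i a) (g.map i)).coeff j = i ((taylor a g).coeff j) := by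
  rw [taylor_apply, taylor_apply, ← coeff_map, Polynomial.map_comp]
  simp

/-- The filter of elements of `F` which are close to `x`. -/
def closeFilter (i : F →+* K₁) (v : Valuation K₁ Γ₁) (x : K₁) : Filter F :=
  ⨅ b, 𝓟 {a | v (x - i a) ≤ v (x - i b)}

/-- The values of `g` near `x` are governed by its value at `x`. -/
def ConstTermDominates (p : ℕ) (i : F →+* K₁) (v : Valuation K₁ Γ₁) (x : K₁) (g : F[X]) : Prop :=
  (g.map i).eval x ≠ 0 ∧ ∀ N : ℕ, ∀ᶠ a in closeFilter i v x, ∀ j, 1 ≤ j →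
    v ((taylor x (g.map i)).coeff j * (x - i a) ^ j) ≤ v (p : K₁) ^ N * v ((g.map i).eval x)

theorem closeFilter_neBot (i : F →+* K₁) (v : Valuation K₁ Γ₁) (x : K₁) :
    (closeFilter i v x).NeBot := by
  refine iInf_neBot_of_directed' ?_ fun b => ?_
  · intro a b
    rcases le_total (v (x - i a)) (v (x - i b)) with e | e
    · exact ⟨a, principal_mono.2 fun c hc => hc, principal_mono.2 fun c hc => le_trans hc e⟩
    · exact ⟨b, principal_mono.2 fun c hc => le_trans hc e, principal_mono.2 fun c hc => hc⟩
  · rw [principal_neBot_iff]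
    exact ⟨b, le_refl _⟩

theorem eventually_closeFilter_le (i : F →+* K₁) (v : Valuation K₁ Γ₁) (x : K₁) (b : F) :
    ∀ᶠ a in closeFilter i v x, v (x - i a) ≤ v (x - i b) :=
  mem_iInf_of_mem b (mem_principal_self _)

section

variable {v : Valuation K₁ Γ₁} {i : F →+* K₁} {x : K₁}

theorem eventually_closeFilter_le_pow (h : PadicLike p v)
    (hx : ∀ a, ∃ a', v (x - i a') < v (x - i a)) (b : F) (N : ℕ) :
    ∀ᶠ a in closeFilter i v x, v (x - i a) ≤ v (p : K₁) ^ N * v (x - i b) := by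
  suffices ∃ b', v (x - i b') ≤ v (p : K₁) ^ N * v (x - i b) by
    obtain ⟨b', hb'⟩ := this
    exact (eventually_closeFilter_le i v x b').mono fun a ha => ha.trans hb'
  induction N with
  | zero => exact ⟨b, by simp⟩
  | succ N ih =>
    obtain ⟨b', hb'⟩ := ih
    obtain ⟨b'', hb''⟩ := hx b'
    refine ⟨b'', ?_⟩
    have h0 : 0 < v (x - i b') := zero_le.trans_lt hb''
    have := h.le_of_lt_one ((x - i b'') / (x - i b'))
      (by rw [map_div₀]; exact (div_lt_one₀ h0).2 hb'')
    rw [map_div₀, div_le_iff₀ h0] at this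
    refine this.trans ?_
    rw [pow_succ', mul_assoc]
    gcongr

theorem ConstTermDominates.map_eval_sub_le {g : F[X]} {B : Γ₁} {a : F}
    (ha : ∀ j, 1 ≤ j → v ((taylor x (g.map i)).coeff j * (x - i a) ^ j) ≤ B) :
    v (i (g.eval a) - (g.map i).eval x) ≤ B := by
  have := v.eval_sub_eval_le_of_taylor_coeff_le (a := i a) (c := x - i a) ha
    (by rw [← v.map_neg, neg_sub])
  rwa [eval_map_apply] at this

theorem approximates_of_constTermDominates (h : PadicLike p v)
    (hg : ∀ g : F[X], g ≠ 0 → ConstTermDominates p i v x g) :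
    Approximates i x (closeFilter i v x) := by
  intro g hg0 M hM
  obtain ⟨hgx, hev⟩ := hg g hg0
  obtain ⟨N, -, hN⟩ := h.exists_eq_mul_pow M hM
  filter_upwards [hev N] with a ha
  obtain ⟨w, hw, e⟩ := hN _ _ hgx (ConstTermDominates.map_eval_sub_le ha)
  refine ⟨fun h0 => ?_, w⁻¹, inv_ne_zero hw, ?_⟩
  · rw [h0, map_zero, eq_comm] at e
    exact mul_ne_zero hgx (pow_ne_zero _ hw) e
  · rw [e, ← eval_map, inv_pow, mul_assoc, mul_inv_cancel₀ (pow_ne_zero _ hw), mul_one]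

/-- A polynomial of minimal degree whose constant term does not dominate is dominated by its
linear term. -/
theorem linear_term_dominates [CharZero F] (h : PadicLike p v)
    (hx : ∀ a, ∃ a', v (x - i a') < v (x - i a)) {g : F[X]} (hg0 : g ≠ 0)
    (hg : ¬ ConstTermDominates p i v x g)
    (hmin : ∀ f : F[X], f ≠ 0 → f.natDegree < g.natDegree → ConstTermDominates p i v x f) :
    (taylor x (g.map i)).coeff 1 ≠ 0 ∧
    (∀ N : ℕ, ∀ᶠ a in closeFilter i v x, ∀ j, 1 ≤ j →
      v ((taylor x (g.map i)).coeff (j + 1) * (x - i a) ^ j) ≤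
        v (p : K₁) ^ N * v ((taylor x (g.map i)).coeff 1)) ∧
    ∀ b, v ((taylor x (g.map i)).coeff 0) ≤ v ((taylor x (g.map i)).coeff 1 * (x - i b)) := by
  have hchar := h.charZero
  set T := taylor x (g.map i) with hT
  have hT0 : T.coeff 0 = (g.map i).eval x := taylor_coeff_zero _ _
  have hdeg : g.natDegree ≠ 0 := by
    intro hd
    obtain ⟨c, rfl⟩ := natDegree_eq_zero.1 hd
    refine hg ⟨?_, fun N => Eventually.of_forall fun a j hj => ?_⟩
    · simpa using hg0
    · rw [Polynomial.map_C, taylor_C, coeff_C, if_neg (by omega)]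
      simp
  have hder : derivative g ≠ 0 := fun h0 => hdeg (derivative_eq_zero.1 h0)
  obtain ⟨hd0, hd⟩ := hmin _ hder (natDegree_derivative_lt hdeg)
  rw [← taylor_coeff_zero, ← derivative_map, coeff_taylor_derivative] at hd0
  have hT1 : T.coeff 1 ≠ 0 := by
    intro h0
    simp [← hT, h0] at hd0
  obtain ⟨C, hC⟩ : ∃ C : ℕ, ∀ j, 1 ≤ j → j ≤ g.natDegree → v (p : K₁) ^ C ≤ v ((j : K₁) + 1) := by
    have : ∀ j : ℕ, ∃ C : ℕ, v (p : K₁) ^ C ≤ v ((j : K₁) + 1) := fun j => by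
      obtain ⟨C, hC⟩ := h.exists_pow_le_natCast (j + 1) (by omega)
      exact ⟨C, by exact_mod_cast hC⟩
    choose C hC using this
    exact ⟨(Finset.range (g.natDegree + 1)).sup C, fun j _ hj =>
      (h.pow_le_pow (Finset.le_sup (Finset.mem_range.2 (by omega)))).trans (hC j)⟩
  have hD : ∀ N : ℕ, ∀ᶠ a in closeFilter i v x, ∀ j, 1 ≤ j →
      v (T.coeff (j + 1) * (x - i a) ^ j) ≤ v (p : K₁) ^ N * v (T.coeff 1) := by
    intro N
    filter_upwards [hd (N + C)] with a ha j hj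
    rcases le_or_gt j g.natDegree with hjd | hjd
    · have h1 := ha j hj
      rw [← taylor_coeff_zero, ← derivative_map, coeff_taylor_derivative, coeff_taylor_derivative,
        ← hT] at h1
      simp only [Nat.cast_zero, zero_add, mul_one] at h1
      have hCp : 0 < v (p : K₁) ^ C := pow_pos h.map_p_pos _
      refine (mul_le_mul_iff_left₀ hCp).1 ?_
      calc v (T.coeff (j + 1) * (x - i a) ^ j) * v (p : K₁) ^ C
          ≤ v (T.coeff (j + 1) * (x - i a) ^ j) * v ((j : K₁) + 1) := by
            gcongr
            exact hC j hj hjd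
        _ = v (T.coeff (j + 1) * (j + 1) * (x - i a) ^ j) := by
            rw [← map_mul]; congr 1; ring
        _ ≤ _ := h1
        _ = _ := by rw [pow_add]; ac_rfl
    · have : T.coeff (j + 1) = 0 := coeff_eq_zero_of_natDegree_lt (by
        rw [hT, natDegree_taylor, natDegree_map]; omega)
      simp [this]
  refine ⟨hT1, hD, fun b => ?_⟩
  by_contra! hlt
  refine hg ⟨?_, fun N => ?_⟩
  · rw [← hT0]
    exact v.ne_zero_iff.1 (zero_le.trans_lt hlt).ne'
  · rw [← hT0]
    filter_upwards [hD 0, eventually_closeFilter_le_pow h hx b N] with a ha hab j hj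
    have hkey : v (T.coeff 1) * v (x - i a) ≤ v (p : K₁) ^ N * v (T.coeff 0) := by
      calc v (T.coeff 1) * v (x - i a) ≤ v (T.coeff 1) * (v (p : K₁) ^ N * v (x - i b)) := by
            gcongr
        _ = v (p : K₁) ^ N * v (T.coeff 1 * (x - i b)) := by rw [map_mul]; ac_rfl
        _ ≤ _ := by gcongr
    obtain ⟨j, rfl⟩ := Nat.exists_eq_add_of_le hj
    rcases Nat.eq_zero_or_pos j with rfl | hj0
    · simpa [← hT] using hkey
    · have := ha j hj0
      rw [pow_zero, one_mul] at this
      rw [← hT, add_comm, pow_succ, ← mul_assoc, map_mul]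
      exact (mul_le_mul_left this _).trans hkey

end

end Dense

section Newton

variable {p : ℕ} [Fact p.Prime] {F K₁ K₂ Γ₁ Γ₂ : Type*} [Field F] [Field K₁] [Field K₂]
    [LinearOrderedCommGroupWithZero Γ₁] [LinearOrderedCommGroupWithZero Γ₂]

/-- The polynomial `g`, recentred at `a` with scale `c`, and with linear coefficient one. -/
noncomputable def newtonPoly (g : F[X]) (a c : F) : F[X] :=
  C (c * (taylor a g).coeff 1)⁻¹ * (taylor a g).comp (C c * X)

theorem newtonPoly_coeff (g : F[X]) (a c : F) (j : ℕ) :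
    (newtonPoly g a c).coeff j = (taylor a g).coeff j * c ^ j / (c * (taylor a g).coeff 1) := by
  rw [newtonPoly, coeff_C_mul, comp_C_mul_X_coeff, div_eq_inv_mul]

theorem newtonPoly_eval (i : F →+* K₁) (g : F[X]) (a c : F) (y : K₁) :
    ((newtonPoly g a c).map i).eval y =
      i (c * (taylor a g).coeff 1)⁻¹ * g.eval₂ i (i c * y + i a) := by
  rw [newtonPoly, taylor_apply]
  simp [eval_map, eval₂_comp]

section

variable {v : Valuation K₁ Γ₁} {i : F →+* K₁} {g : F[X]} {a c : F}

theorem PadicLike.exists_newton_root (h : PadicLike p v) (hc : c ≠ 0)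
    (ha : (taylor a g).coeff 1 ≠ 0) (h0 : v (i ((newtonPoly g a c).coeff 0)) ≤ 1)
    (h2 : ∀ j, 2 ≤ j → v (i ((newtonPoly g a c).coeff j)) < 1) :
    ∃ z, g.eval₂ i z = 0 ∧ v (z - i a) ≤ v (i c) := by
  obtain ⟨y, hy, hy'⟩ := h.exists_root ((newtonPoly g a c).map i) (by simpa using h0)
    (by rw [coeff_map, newtonPoly_coeff, pow_one, mul_comm, div_self (mul_ne_zero hc ha), map_one])
    (by simpa using h2)
  rw [newtonPoly_eval, mul_eq_zero, map_eq_zero, inv_eq_zero] at hy'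
  refine ⟨_, hy'.resolve_left (mul_ne_zero hc ha), ?_⟩
  rw [add_sub_cancel_right, map_mul]
  exact mul_le_of_le_one_right' hy

theorem PadicLike.newton_root_unique (h : PadicLike p v) (hc : c ≠ 0)
    (ha : (taylor a g).coeff 1 ≠ 0)
    (h2 : ∀ j, 2 ≤ j → v (i ((newtonPoly g a c).coeff j)) < 1) {z z' : K₁}
    (hz : g.eval₂ i z = 0) (hz' : g.eval₂ i z' = 0) (hza : v (z - i a) ≤ v (i c))
    (hza' : v (z' - i a) ≤ v (i c)) : z = z' := by
  have hic : i c ≠ 0 := (map_ne_zero i).2 hc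
  have hvc : 0 < v (i c) := zero_lt_iff.2 (v.ne_zero_iff.2 hic)
  have := h.eq_of_eval_eq_zero (P := (newtonPoly g a c).map i) (y := (z - i a) / i c)
    (y' := (z' - i a) / i c)
    (by rw [coeff_map, newtonPoly_coeff, pow_one, mul_comm, div_self (mul_ne_zero hc ha), map_one])
    (by simpa using h2) (by rw [map_div₀]; exact (div_le_one₀ hvc).2 hza)
    (by rw [map_div₀]; exact (div_le_one₀ hvc).2 hza')
    (by rw [newtonPoly_eval, mul_div_cancel₀ _ hic, sub_add_cancel, hz, mul_zero])
    (by rw [newtonPoly_eval, mul_div_cancel₀ _ hic, sub_add_cancel, hz', mul_zero])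
  field_simp at this
  linear_combination this

theorem newtonPoly_coeff_bounds {x : K₁} (h : PadicLike p v)
    (hT : (taylor x (g.map i)).coeff 1 ≠ 0) (hca : v (i c) = v (x - i a)) (hc : c ≠ 0)
    (hlin : ∀ j, 1 ≤ j → v ((taylor x (g.map i)).coeff (j + 1) * (x - i a) ^ j) ≤
        v (p : K₁) * v ((taylor x (g.map i)).coeff 1))
    (h0 : v ((taylor x (g.map i)).coeff 0) ≤ v ((taylor x (g.map i)).coeff 1 * (x - i a))) :
    (taylor a g).coeff 1 ≠ 0 ∧ v (i ((newtonPoly g a c).coeff 0)) ≤ 1 ∧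
      ∀ j, 2 ≤ j → v (i ((newtonPoly g a c).coeff j)) < 1 := by
  set T := taylor x (g.map i) with hTdef
  have hax : v (i a - x) ≤ v (i c) := by rw [hca, ← v.map_neg, neg_sub]
  have hlin' : ∀ j, 1 ≤ j → v (T.coeff (j + 1) * i c ^ j) ≤ v (p : K₁) * v (T.coeff 1) := by
    intro j hj
    have := hlin j hj
    rwa [map_mul, map_pow, ← hca, ← map_pow, ← map_mul] at this
  have hvT : 0 < v (T.coeff 1) := zero_lt_iff.2 (v.ne_zero_iff.2 hT)
  have hvc : 0 < v (i c) := zero_lt_iff.2 (v.ne_zero_iff.2 ((map_ne_zero i).2 hc))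
  have hb2 : ∀ j, 2 ≤ j → v (T.coeff j * i c ^ j) ≤ v (p : K₁) * v (T.coeff 1 * i c) := by
    intro j hj
    obtain ⟨j, rfl⟩ := Nat.exists_eq_add_of_le hj
    rw [add_comm, show j + 2 = (j + 1) + 1 by ring, pow_succ, ← mul_assoc, map_mul,
      map_mul _ _ (i c),
      ← mul_assoc]
    exact mul_le_mul_left (hlin' (j + 1) (by omega)) _
  have hb0 : ∀ j, 0 ≤ j → v (T.coeff j * i c ^ j) ≤ v (T.coeff 1 * i c) := by
    intro j _
    match j with
    | 0 =>
      rw [map_mul, ← hca, ← map_mul] at h0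
      simpa using h0
    | 1 => simp
    | j + 2 => exact (hb2 _ (by omega)).trans (mul_le_of_le_one_left' h.lt_one.le)
  have hc1 : v (i ((taylor a g).coeff 1)) = v (T.coeff 1) := by
    apply v.map_eq_of_sub_lt
    refine lt_of_le_of_lt ?_ (mul_lt_of_lt_one_left hvT h.lt_one)
    have := v.eval_sub_eval_le_of_taylor_coeff_le (G := derivative (g.map i)) (x := x) (a := i a)
      (c := i c) (B := v (p : K₁) * v (T.coeff 1)) (fun j hj => by
        rw [coeff_taylor_derivative, ← hTdef]
        refine le_trans ?_ (hlin' j hj)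
        rw [mul_assoc, mul_left_comm, map_mul]
        refine mul_le_of_le_one_left' ?_
        exact_mod_cast v.map_natCast_le_one' (j + 1)) hax
    rwa [← taylor_coeff_one, ← taylor_coeff_one, coeff_taylor_map] at this
  have ha1 : (taylor a g).coeff 1 ≠ 0 := by
    intro hh
    rw [hh, map_zero, map_zero] at hc1
    exact hvT.ne hc1
  have hden : v (i (c * (taylor a g).coeff 1)) = v (T.coeff 1 * i c) := by
    rw [map_mul, map_mul, hc1, map_mul, mul_comm]
  have hpos : 0 < v (T.coeff 1 * i c) := by
    rw [map_mul]
    exact mul_pos hvT hvc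
  refine ⟨ha1, ?_, fun j hj => ?_⟩
  · rw [newtonPoly_coeff, map_div₀, map_div₀, hden, div_le_one₀ hpos]
    have := v.taylor_coeff_le_of_dist_le hb0 hax 0 le_rfl
    rwa [coeff_taylor_map, ← map_pow, ← map_mul] at this
  · rw [newtonPoly_coeff, map_div₀, map_div₀, hden, div_lt_one₀ hpos]
    have := v.taylor_coeff_le_of_dist_le hb2 hax j hj
    rw [coeff_taylor_map, ← map_pow, ← map_mul] at this
    exact this.trans_lt (mul_lt_of_lt_one_left hpos h.lt_one)

end

variable {v₁ : Valuation K₁ Γ₁} {v₂ : Valuation K₂ Γ₂} {i₁ : F →+* K₁} {i₂ : F →+* K₂}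

theorem PowCompat.exists_common_newton_root (hc : PowCompat i₁ i₂) (h₁ : PadicLike p v₁)
    (h₂ : PadicLike p v₂) {x : K₁} (hx : ∀ a, ∃ a', v₁ (x - i₁ a') < v₁ (x - i₁ a)) {g : F[X]}
    (hT : (taylor x (g.map i₁)).coeff 1 ≠ 0)
    (hlin : ∀ N : ℕ, ∀ᶠ a in closeFilter i₁ v₁ x, ∀ j, 1 ≤ j →
      v₁ ((taylor x (g.map i₁)).coeff (j + 1) * (x - i₁ a) ^ j) ≤
        v₁ (p : K₁) ^ N * v₁ ((taylor x (g.map i₁)).coeff 1))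
    (h0 : ∀ b, v₁ ((taylor x (g.map i₁)).coeff 0) ≤
      v₁ ((taylor x (g.map i₁)).coeff 1 * (x - i₁ b))) :
    ∃ z z', g.eval₂ i₁ z = 0 ∧ g.eval₂ i₂ z' = 0 ∧ ∀ᶠ a in closeFilter i₁ v₁ x, ∃ c,
      v₁ (i₁ c) = v₁ (x - i₁ a) ∧ v₁ (z - i₁ a) ≤ v₁ (i₁ c) ∧ v₂ (z' - i₂ a) ≤ v₂ (i₂ c) := by
  have hlin1 := hlin 1
  simp only [pow_one] at hlin1
  have key : ∀ a, (∀ j, 1 ≤ j → v₁ ((taylor x (g.map i₁)).coeff (j + 1) * (x - i₁ a) ^ j) ≤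
      v₁ (p : K₁) * v₁ ((taylor x (g.map i₁)).coeff 1)) → ∃ c z z', c ≠ 0 ∧
      v₁ (i₁ c) = v₁ (x - i₁ a) ∧ g.eval₂ i₁ z = 0 ∧ g.eval₂ i₂ z' = 0 ∧
      v₁ (z - i₁ a) ≤ v₁ (i₁ c) ∧ v₂ (z' - i₂ a) ≤ v₂ (i₂ c) ∧
      (∀ y, g.eval₂ i₁ y = 0 → v₁ (y - i₁ a) ≤ v₁ (i₁ c) → y = z) ∧
      (∀ y, g.eval₂ i₂ y = 0 → v₂ (y - i₂ a) ≤ v₂ (i₂ c) → y = z') := by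
    intro a ha
    obtain ⟨a', ha'⟩ := hx a
    have hca : v₁ (i₁ (a' - a)) = v₁ (x - i₁ a) := by
      apply v₁.map_eq_of_sub_lt
      rwa [map_sub i₁, ← v₁.map_neg, show -(i₁ a' - i₁ a - (x - i₁ a)) = x - i₁ a' by ring]
    have hc0 : a' - a ≠ 0 := by
      intro hh
      rw [hh, map_zero, map_zero] at hca
      rw [← hca] at ha'
      exact not_lt_zero ha'
    obtain ⟨e1, e2, e3⟩ := newtonPoly_coeff_bounds h₁ hT hca hc0 ha (h0 a)
    have e2' := (hc.le_one_iff h₁ h₂ _).1 e2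
    have e3' : ∀ j, 2 ≤ j → v₂ (i₂ ((newtonPoly g a (a' - a)).coeff j)) < 1 := fun j hj => by
      have := (hc.lt_iff h₁ h₂ ((newtonPoly g a (a' - a)).coeff j) 1).1 (by simpa using e3 j hj)
      simpa using this
    obtain ⟨z, hz, hza⟩ := h₁.exists_newton_root hc0 e1 e2 e3
    obtain ⟨z', hz', hza'⟩ := h₂.exists_newton_root hc0 e1 e2' e3'
    exact ⟨a' - a, z, z', hc0, hca, hz, hz', hza, hza',
      fun y hy hya => h₁.newton_root_unique hc0 e1 e3 hy hz hya hza,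
      fun y hy hya => h₂.newton_root_unique hc0 e1 e3' hy hz' hya hza'⟩
  have := closeFilter_neBot i₁ v₁ x
  obtain ⟨a₀, ha₀⟩ := hlin1.exists
  obtain ⟨c₀, z, z', hc₀, hca₀, hz, hz', -, -, huniq, huniq'⟩ := key a₀ ha₀
  refine ⟨z, z', hz, hz', ?_⟩
  filter_upwards [hlin1, eventually_closeFilter_le i₁ v₁ x a₀] with a ha hle
  obtain ⟨c, y, y', -, hca, hy, hy', hya, hya', -, -⟩ := key a ha
  have hcc : v₁ (i₁ c) ≤ v₁ (i₁ c₀) := by rwa [hca, hca₀]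
  have hcc' := (hc.le_iff h₁ h₂ _ _).1 hcc
  have haa : v₁ (i₁ (a - a₀)) ≤ v₁ (i₁ c₀) := by
    rw [map_sub, show i₁ a - i₁ a₀ = (x - i₁ a₀) - (x - i₁ a) by ring, hca₀]
    exact v₁.map_sub_le le_rfl hle
  have haa' := (hc.le_iff h₁ h₂ _ _).1 haa
  rw [map_sub] at haa haa'
  have e : y = z := huniq y hy (by
    rw [show y - i₁ a₀ = (y - i₁ a) + (i₁ a - i₁ a₀) by ring]
    exact v₁.map_add_le (hya.trans hcc) haa)
  have e' : y' = z' := huniq' y' hy' (by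
    rw [show y' - i₂ a₀ = (y' - i₂ a) + (i₂ a - i₂ a₀) by ring]
    exact v₂.map_add_le (hya'.trans hcc') haa')
  exact ⟨c, hca, e ▸ hya, e' ▸ hya'⟩

/-- Along a dense situation over a maximal pair every polynomial is dominated by its constant
term. -/
theorem PowCompat.constTermDominates (hc : PowCompat i₁ i₂) (h₁ : PadicLike p v₁)
    (h₂ : PadicLike p v₂) (hmax : ∀ z z', IsAdjoinable i₁ i₂ z z' → ∃ a, i₁ a = z) {x : K₁}
    (hx : ∀ a, ∃ a', v₁ (x - i₁ a') < v₁ (x - i₁ a)) (g : F[X]) (hg : g ≠ 0) :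
    ConstTermDominates p i₁ v₁ x g := by
  have hchar := h₁.charZero
  have hF : CharZero F := ⟨fun a b hab => by
    have : ((a : ℕ) : K₁) = b := by rw [← map_natCast i₁, ← map_natCast i₁, hab]
    exact_mod_cast this⟩
  have := closeFilter_neBot i₁ v₁ x
  induction hn : g.natDegree using Nat.strong_induction_on generalizing g with
  | _ n ih =>
    subst hn
    by_contra hcon
    have hmin : ∀ f : F[X], f ≠ 0 → f.natDegree < g.natDegree → ConstTermDominates p i₁ v₁ x f :=
      fun f hf hfg => ih _ hfg f hf rfl
    obtain ⟨hT, hlin, h0⟩ := linear_term_dominates h₁ hx hg hcon hmin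
    obtain ⟨z, z', hz, hz', hev⟩ := hc.exists_common_newton_root h₁ h₂ hx hT hlin h0
    obtain ⟨d, hd⟩ := hmax z z' <| by
      intro f
      have hf1 : f.eval₂ i₁ z = (f % g).eval₂ i₁ z := by
        conv_lhs => rw [← EuclideanDomain.mod_add_div f g]
        rw [eval₂_add, eval₂_mul, hz, zero_mul, add_zero]
      have hf2 : f.eval₂ i₂ z' = (f % g).eval₂ i₂ z' := by
        conv_lhs => rw [← EuclideanDomain.mod_add_div f g]
        rw [eval₂_add, eval₂_mul, hz', zero_mul, add_zero]
      rw [hf1, hf2]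
      rcases eq_or_ne (f % g) 0 with hr | hr
      · left; simp [hr]
      right
      have hdeg : (f % g).natDegree < g.natDegree :=
        natDegree_lt_natDegree hr (EuclideanDomain.mod_lt f hg)
      generalize f % g = r at hr hdeg
      intro m hm
      obtain ⟨N, hN1, hN⟩ := h₁.exists_samePowClass_of_close h₂ m hm
      obtain ⟨hrx, hrd⟩ := hmin r hr hdeg
      obtain ⟨b, ⟨c, hcb, hzb, hzb'⟩, hrb⟩ := (hev.and (hrd N)).exists
      have hvr : 0 < v₁ ((r.map i₁).eval x) := zero_lt_iff.2 (v₁.ne_zero_iff.2 hrx)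
      have hval : v₁ (i₁ (r.eval b)) = v₁ ((r.map i₁).eval x) := by
        apply v₁.map_eq_of_sub_lt
        refine (ConstTermDominates.map_eval_sub_le hrb).trans_lt ?_
        exact mul_lt_of_lt_one_left hvr (pow_lt_one₀ zero_le h₁.lt_one (by omega))
      have hrb0 : r.eval b ≠ 0 := by
        intro hh
        rw [hh, map_zero, map_zero] at hval
        exact hvr.ne hval
      have hbound : ∀ j, 1 ≤ j → v₁ ((taylor (i₁ b) (r.map i₁)).coeff j * i₁ c ^ j) ≤
          v₁ (p : K₁) ^ N * v₁ (i₁ (r.eval b)) := by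
        intro j hj
        refine v₁.taylor_coeff_le_of_dist_le (x := x) (k := 1) (fun j hj => ?_) ?_ j hj
        · rw [hval, map_mul, map_pow, hcb, ← map_pow, ← map_mul]
          exact hrb j hj
        · rw [hcb, ← v₁.map_neg, neg_sub]
      have hbound' : ∀ j, 1 ≤ j → v₂ ((taylor (i₂ b) (r.map i₂)).coeff j * i₂ c ^ j) ≤
          v₂ (p : K₂) ^ N * v₂ (i₂ (r.eval b)) := by
        intro j hj
        have := (hc.le_iff h₁ h₂ ((taylor b r).coeff j * c ^ j) (p ^ N * r.eval b)).1 (by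
          simpa [coeff_taylor_map] using hbound j hj)
        simpa [coeff_taylor_map] using this
      refine hN _ (i₁ (r.eval b)) _ (i₂ (r.eval b)) (hc _ hrb0 m hm) ?_ ?_
      · have := v₁.eval_sub_eval_le_of_taylor_coeff_le hbound hzb
        rwa [eval_map_apply, eval_map] at this
      · have := v₂.eval_sub_eval_le_of_taylor_coeff_le hbound' hzb'
        rwa [eval_map_apply, eval_map] at this
    obtain ⟨d', hd'⟩ := hx d
    obtain ⟨a, ⟨c, hca, hza, -⟩, had⟩ := (hev.and (eventually_closeFilter_le i₁ v₁ x d')).exists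
    have : v₁ (x - i₁ d) ≤ v₁ (x - i₁ a) := by
      rw [show x - i₁ d = (x - i₁ a) - (z - i₁ a) by rw [hd]; ring]
      exact v₁.map_sub_le le_rfl (by rwa [hca] at hza)
    exact absurd (this.trans had) (not_le.2 hd')

/-- Over a maximal pair, every element outside of `F` is, up to a fractional linear change of
variables, approximated by elements of `F`. -/
theorem PowCompat.exists_approximates (hc : PowCompat i₁ i₂) (h₁ : PadicLike p v₁)
    (h₂ : PadicLike p v₂) (hmax : ∀ z z', IsAdjoinable i₁ i₂ z z' → ∃ a, i₁ a = z) {x : K₁}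
    (hx : ∀ a, i₁ a ≠ x) :
    ∃ z a, (x = z + i₁ a ∨ x = z⁻¹ + i₁ a) ∧
      ∃ 𝓕 : Filter F, 𝓕.NeBot ∧ Approximates i₁ z 𝓕 := by
  by_cases hmin : ∀ a, ∃ a', v₁ (x - i₁ a') < v₁ (x - i₁ a)
  · exact ⟨x, 0, by simp, _, closeFilter_neBot i₁ v₁ x,
      approximates_of_constTermDominates h₁ (hc.constTermDominates h₁ h₂ hmax hmin)⟩
  · push Not at hmin
    obtain ⟨a, ha⟩ := hmin
    have hpure : ∀ s : K₁, s ≠ 0 → ∀ n : ℕ, n ≠ 0 → ∀ c, v₁ s ^ n = v₁ (i₁ c) →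
        ∃ d, v₁ s = v₁ (i₁ d) := fun s hs n hn c hsc =>
      hc.exists_map_eq_of_pow h₁ h₂ hmax hs hn hsc
    have hz0 : x - i₁ a ≠ 0 := sub_ne_zero.2 (hx a).symm
    have hz : ∀ c, v₁ (x - i₁ a) ≠ v₁ (i₁ c) := by
      intro c hzc
      have hvc : 0 < v₁ (i₁ c) := hzc ▸ zero_lt_iff.2 (v₁.ne_zero_iff.2 hz0)
      have hc0 : i₁ c ≠ 0 := v₁.ne_zero_iff.1 hvc.ne'
      obtain ⟨n, hn⟩ := h₁.exists_natCast_sub_lt ((x - i₁ a) / i₁ c) (by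
        rw [map_div₀, hzc, div_self hvc.ne'])
      have := ha (a + n * c)
      rw [hzc] at this
      refine absurd this (not_le.2 ?_)
      have e : x - i₁ (a + n * c) = ((x - i₁ a) / i₁ c - n) * i₁ c := by
        rw [sub_mul, div_mul_cancel₀ _ hc0]; simp; ring
      rw [e, map_mul]
      exact mul_lt_of_lt_one_left hvc hn
    rcases lt_or_ge (v₁ (x - i₁ a)) 1 with hlt | hge
    · exact ⟨x - i₁ a, a, by simp, exists_approximates_of_map_ne h₁ hpure hz hlt⟩
    · refine ⟨(x - i₁ a)⁻¹, a, by simp, exists_approximates_of_map_ne h₁ hpure ?_ ?_⟩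
      · intro c hcz
        apply hz c⁻¹
        rw [map_inv₀, map_inv₀, ← hcz, map_inv₀, inv_inv]
      · rw [map_inv₀]
        exact inv_lt_one_of_one_lt₀ (lt_of_le_of_ne hge (by simpa using (hz 1).symm))

end Newton

section QpFacts

variable {p : ℕ} [Fact p.Prime]

theorem Padic.norm_le_norm_p_of_lt_one {x : ℚ_[p]} (hx : ‖x‖ < 1) : ‖x‖ ≤ ‖(p : ℚ_[p])‖ := by
  have := (Padic.norm_le_pow_iff_norm_lt_pow_add_one x (-1)).2 (by simpa using hx)
  simpa [Padic.norm_p] using this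

theorem Padic.exists_natCast_lt_norm_sub_lt {x : ℚ_[p]} (hx : ‖x‖ ≤ 1) :
    ∃ n : ℕ, n < p ∧ ‖x - n‖ < 1 := by
  obtain ⟨n, hn, h⟩ := PadicInt.exists_mem_range (⟨x, hx⟩ : ℤ_[p])
  refine ⟨n, hn, ?_⟩
  rw [PadicInt.maximalIdeal_eq_span_p, Ideal.mem_span_singleton,
    ← PadicInt.norm_lt_one_iff_dvd] at h
  rw [PadicInt.norm_def] at h
  exact h

theorem Padic.exists_pow_norm_p_lt {ε : ℝ} (hε : 0 < ε) : ∃ N : ℕ, ‖(p : ℚ_[p])‖ ^ N < ε :=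
  exists_pow_lt_of_lt_one hε (Padic.norm_p_lt_one (p := p))

theorem Padic.exists_root_of_coeff {g : ℚ_[p][X]} (h0 : ‖g.coeff 0‖ ≤ 1) (h1 : g.coeff 1 = 1)
    (h2 : ∀ i, 2 ≤ i → ‖g.coeff i‖ < 1) : ∃ y, ‖y‖ ≤ 1 ∧ g.eval y = 0 := by
  have hg : g ∈ Polynomial.lifts (PadicInt.Coe.ringHom (p := p)) := by
    rw [Polynomial.lifts_iff_coeff_lifts]
    intro n
    have : ‖g.coeff n‖ ≤ 1 := by
      match n with
      | 0 => exact h0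
      | 1 => simp [h1]
      | n + 2 => exact (h2 _ (by omega)).le
    exact ⟨⟨_, this⟩, rfl⟩
  obtain ⟨G, rfl⟩ := (Polynomial.mem_lifts _).1 hg
  have hG1 : G.coeff 1 = 1 := by
    rw [coeff_map] at h1
    exact Subtype.ext h1
  have hdiv : C (p : ℤ_[p]) ∣ G.divX.divX := by
    rw [Polynomial.C_dvd_iff_dvd_coeff]
    intro i
    rw [← PadicInt.norm_lt_one_iff_dvd, coeff_divX, coeff_divX]
    have := h2 (i + 1 + 1) (by omega)
    rw [coeff_map] at this
    exact this
  obtain ⟨E, hE⟩ := hdiv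
  have hGE : G = C (p : ℤ_[p]) * E * X * X + X + C (G.coeff 0) := by
    conv_lhs => rw [← divX_mul_X_add G, ← divX_mul_X_add G.divX, hE, coeff_divX, zero_add, hG1]
    simp only [map_one]
    ring
  set c := G.coeff 0
  have hnp : ∀ z : ℤ_[p], ‖(p : ℤ_[p]) * z‖ < 1 := fun z ↦
    PadicInt.norm_lt_one_iff_dvd _ |>.2 ⟨z, rfl⟩
  have hder : ‖G.derivative.aeval (-c)‖ = 1 := by
    have : ∃ z, G.derivative.aeval (-c) = 1 + (p : ℤ_[p]) * z := by
      refine ⟨(derivative (E * X * X)).eval (-c), ?_⟩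
      rw [hGE]
      simp
      ring
    obtain ⟨z, hz⟩ := this
    rw [hz]
    have := PadicInt.norm_add_eq_max_of_ne (q := (1 : ℤ_[p])) (r := (p : ℤ_[p]) * z)
      (by rw [norm_one]; exact (hnp z).ne')
    rw [this, norm_one, max_eq_left (hnp z).le]
  obtain ⟨y, hy, -⟩ := hensels_lemma (F := G) (a := -c) (by
    rw [hder, one_pow]
    have : G.aeval (-c) = (p : ℤ_[p]) * (E.eval (-c) * c * c) := by
      rw [hGE]
      simp
      ring
    rw [this]
    exact hnp _)
  refine ⟨y, y.2, ?_⟩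
  rw [eval_map]
  have := congrArg (PadicInt.Coe.ringHom (p := p)) hy
  rw [map_zero, Polynomial.coe_aeval_eq_eval, ← Polynomial.eval₂_at_apply] at this
  exact this

theorem Padic.exists_one_add_eq_pow {n : ℕ} {u : ℚ_[p]} (hu : ‖u‖ < ‖(n : ℚ_[p])‖ ^ 2) :
    ∃ w : ℚ_[p], 1 + u = w ^ n := by
  have hn1 : ‖(n : ℚ_[p])‖ ≤ 1 := by simpa using Padic.norm_int_le_one (p := p) n
  have hu1 : ‖u‖ ≤ 1 := hu.le.trans (pow_le_one₀ (norm_nonneg _) hn1)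
  obtain ⟨u, rfl⟩ : ∃ u' : ℤ_[p], (u' : ℚ_[p]) = u := ⟨⟨u, hu1⟩, rfl⟩
  have hz0 : (X ^ n - C (1 + u) : ℤ_[p][X]).aeval (1 : ℤ_[p]) = -u := by simp
  have hz1 : (X ^ n - C (1 + u) : ℤ_[p][X]).derivative.aeval (1 : ℤ_[p]) = n := by
    simp [derivative_X_pow]
  obtain ⟨z, hz, -⟩ := hensels_lemma (F := (X ^ n - C (1 + u) : ℤ_[p][X])) (a := 1) (by
    rwa [hz0, hz1, norm_neg, PadicInt.norm_def, PadicInt.norm_def, PadicInt.coe_natCast])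
  refine ⟨z, ?_⟩
  simp only [map_sub, map_pow, aeval_X, aeval_C, Algebra.algebraMap_self, RingHom.id_apply,
    sub_eq_zero] at hz
  have := congrArg (fun a : ℤ_[p] ↦ (a : ℚ_[p])) hz
  simpa using this.symm

theorem Padic.exists_unit_eq {n : ℕ} (hn : n ≠ 0) : ∃ B : ℕ, ∀ x : ℚ_[p], ‖x‖ = 1 →
    ∃ q < B, q ≠ 0 ∧ ∃ w : ℚ_[p], ‖w‖ = 1 ∧ x = q * w ^ n := by
  have hn0 : 0 < ‖(n : ℚ_[p])‖ ^ 2 := by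
    have : (n : ℚ_[p]) ≠ 0 := by exact_mod_cast hn
    positivity
  obtain ⟨N, hN⟩ := Padic.exists_pow_norm_p_lt (p := p) (lt_min hn0 one_pos)
  refine ⟨p ^ N, fun x hx ↦ ?_⟩
  set a := PadicInt.appr (⟨x, hx.le⟩ : ℤ_[p]) N
  have ha : ‖x - a‖ ≤ ‖(p : ℚ_[p])‖ ^ N := by
    have := PadicInt.appr_spec N (⟨x, hx.le⟩ : ℤ_[p])
    rw [← PadicInt.norm_le_pow_iff_mem_span_pow] at this
    rw [PadicInt.norm_def] at this
    rwa [Padic.norm_p, inv_pow, ← zpow_natCast, ← zpow_neg]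
  have ha' := ha.trans_lt hN
  have hna : ‖(a : ℚ_[p])‖ = 1 := by
    have := Padic.add_eq_max_of_ne (q := x) (r := -(x - a)) (by
      rw [norm_neg, hx]; exact (ha'.trans_le (min_le_right _ _)).ne')
    rw [norm_neg, hx, max_eq_left (ha'.trans_le (min_le_right _ _)).le] at this
    simpa using this
  have ha0 : (a : ℚ_[p]) ≠ 0 := by
    intro h
    simp [h] at hna
  obtain ⟨w, hw⟩ := Padic.exists_one_add_eq_pow (p := p) (n := n) (u := (x - a) / a) (by
    rw [norm_div, hna, div_one]; exact ha'.trans_le (min_le_left _ _))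
  have hxw : x = a * w ^ n := by
    rw [← hw]
    field_simp
    ring
  refine ⟨a, PadicInt.appr_lt _ _, by exact_mod_cast ha0, w, ?_, hxw⟩
  have := congrArg norm hxw
  rw [hx, norm_mul, hna, one_mul, norm_pow] at this
  exact (pow_eq_one_iff_of_nonneg (norm_nonneg _) hn).1 this.symm

theorem Padic.exists_eq {n : ℕ} (hn : n ≠ 0) : ∃ B : ℕ, ∀ x : ℚ_[p], x ≠ 0 →
    ∃ q < B, q ≠ 0 ∧ ∃ w : ℚ_[p], x = q * w ^ n := by
  obtain ⟨B, hB⟩ := Padic.exists_unit_eq (p := p) hn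
  refine ⟨p ^ n * B, fun x hx ↦ ?_⟩
  have hp0 : (p : ℚ_[p]) ≠ 0 := by exact_mod_cast (Fact.out : p.Prime).ne_zero
  have hp : 0 < p := (Fact.out : p.Prime).pos
  set k := x.valuation
  obtain ⟨q, hq, hq0, w, -, hw⟩ := hB (x * (p : ℚ_[p]) ^ (-k)) (by
    have : (p : ℝ) ≠ 0 := by exact_mod_cast hp.ne'
    rw [norm_mul, norm_zpow, Padic.norm_p, Padic.norm_eq_zpow_neg_valuation hx, inv_zpow',
      neg_neg, ← zpow_add₀ this]
    simp [k])
  have hn' : (n : ℤ) ≠ 0 := by exact_mod_cast hn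
  obtain ⟨r, hr⟩ := Int.eq_ofNat_of_zero_le (Int.emod_nonneg k hn')
  have hrn : r < n := by
    have := Int.emod_lt_of_pos k (b := n) (by omega)
    omega
  refine ⟨p ^ r * q, ?_, by positivity, w * (p : ℚ_[p]) ^ (k / n), ?_⟩
  · calc p ^ r * q ≤ p ^ n * q := Nat.mul_le_mul_right _ (Nat.pow_le_pow_right hp hrn.le)
      _ < p ^ n * B := Nat.mul_lt_mul_of_pos_left hq (by positivity)
  · have hk : k = (r : ℤ) + (k / n) * n := by
      have := Int.emod_add_mul_ediv k n
      rw [hr] at this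
      linarith
    calc x = (x * (p : ℚ_[p]) ^ (-k)) * (p : ℚ_[p]) ^ k := by
          rw [mul_assoc, ← zpow_add₀ hp0]; simp
      _ = q * w ^ n * ((p : ℚ_[p]) ^ r * ((p : ℚ_[p]) ^ (k / n)) ^ n) := by
          rw [hw, ← zpow_natCast _ r, ← zpow_natCast ((p : ℚ_[p]) ^ (k / n)) n, ← zpow_mul,
            ← zpow_add₀ hp0, ← hk]
      _ = _ := by push_cast; ring

theorem Padic.norm_le_one_iff_exists (x : ℚ_[p]) :
    ‖x‖ ≤ 1 ↔ ∃ y, y ^ (p + 1) = 1 + p * x ^ (p + 1) := by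
  have hp1 : ‖(p : ℚ_[p])‖ < 1 := Padic.norm_p_lt_one
  constructor
  · intro hx
    have h1 : ‖((p + 1 : ℕ) : ℚ_[p])‖ = 1 := by
      push_cast
      rw [Padic.add_eq_max_of_ne (by rw [norm_one]; exact hp1.ne), norm_one, max_eq_right hp1.le]
    obtain ⟨w, hw⟩ := Padic.exists_one_add_eq_pow (p := p) (n := p + 1) (u := p * x ^ (p + 1)) (by
      rw [h1, norm_mul, norm_pow, one_pow]
      exact mul_lt_one_of_nonneg_of_lt_one_left (norm_nonneg _) hp1
        (pow_le_one₀ (norm_nonneg _) hx))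
    exact ⟨w, hw.symm⟩
  · rintro ⟨y, hy⟩
    by_contra! hx
    have hpR : (1 : ℝ) < p := by exact_mod_cast (Fact.out : p.Prime).one_lt
    have hx0 : x ≠ 0 := by rintro rfl; norm_num at hx
    have hval : x.valuation < 0 := by
      rw [Padic.norm_eq_zpow_neg_valuation hx0] at hx
      have := (one_lt_zpow_iff_right₀ hpR).1 hx
      omega
    have hnorm : ‖(p : ℚ_[p]) * x ^ (p + 1)‖ = (p : ℝ) ^ (-1 + -x.valuation * (p + 1 : ℕ)) := by
      rw [norm_mul, norm_pow, Padic.norm_p, Padic.norm_eq_zpow_neg_valuation hx0,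
        zpow_add₀ (by positivity), zpow_neg_one, zpow_mul, zpow_natCast]
    have hgt : 1 < ‖(p : ℚ_[p]) * x ^ (p + 1)‖ := by
      rw [hnorm]
      apply one_lt_zpow₀ hpR
      have hp2 := (Fact.out : p.Prime).two_le
      push_cast
      nlinarith
    have hsum := Padic.add_eq_max_of_ne (q := (1 : ℚ_[p])) (r := p * x ^ (p + 1))
      (by rw [norm_one]; exact hgt.ne)
    rw [norm_one, max_eq_right hgt.le, ← hy, norm_pow, hnorm] at hsum
    have hy0 : y ≠ 0 := by
      rintro rfl
      rw [norm_zero, zero_pow (by omega)] at hsum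
      have : (0 : ℝ) < (p : ℝ) ^ (-1 + -x.valuation * (p + 1 : ℕ)) := by positivity
      exact absurd hsum this.ne
    rw [Padic.norm_eq_zpow_neg_valuation hy0, ← zpow_natCast, ← zpow_mul] at hsum
    have := zpow_right_injective₀ (by positivity) hpR.ne' hsum
    have hdvd : ((p + 1 : ℕ) : ℤ) ∣ 1 := ⟨y.valuation - x.valuation, by linarith⟩
    have := Int.le_of_dvd one_pos hdvd
    have hp2 := (Fact.out : p.Prime).two_le
    omega

end QpFacts

section GermValuation

variable {ι : Type*} (U : Ultrafilter ι) (p : ℕ) [Fact p.Prime]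

/-- The ring of germs of families of `p`-adic numbers of norm at most one. -/
noncomputable def germValuationSubring : ValuationSubring ((U : Filter ι).Germ ℚ_[p]) where
  carrier := {x | Germ.LiftPred (fun y : ℚ_[p] ↦ ‖y‖ ≤ 1) x}
  mul_mem' := by
    rintro ⟨a⟩ ⟨b⟩ ha hb
    replace ha : ∀ᶠ j in (U : Filter ι), ‖a j‖ ≤ 1 := ha
    replace hb : ∀ᶠ j in (U : Filter ι), ‖b j‖ ≤ 1 := hb
    change ∀ᶠ j in (U : Filter ι), ‖a j * b j‖ ≤ 1
    filter_upwards [ha, hb] with j ha hb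
    rw [norm_mul]
    exact mul_le_one₀ ha (norm_nonneg _) hb
  one_mem' := by
    change ∀ᶠ j in (U : Filter ι), ‖(1 : ℚ_[p])‖ ≤ 1
    simp
  add_mem' := by
    rintro ⟨a⟩ ⟨b⟩ ha hb
    replace ha : ∀ᶠ j in (U : Filter ι), ‖a j‖ ≤ 1 := ha
    replace hb : ∀ᶠ j in (U : Filter ι), ‖b j‖ ≤ 1 := hb
    change ∀ᶠ j in (U : Filter ι), ‖a j + b j‖ ≤ 1
    filter_upwards [ha, hb] with j ha hb
    exact (Padic.nonarchimedean _ _).trans (max_le ha hb)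
  zero_mem' := by
    change ∀ᶠ j in (U : Filter ι), ‖(0 : ℚ_[p])‖ ≤ 1
    simp
  neg_mem' := by
    rintro ⟨a⟩ ha
    replace ha : ∀ᶠ j in (U : Filter ι), ‖a j‖ ≤ 1 := ha
    change ∀ᶠ j in (U : Filter ι), ‖-a j‖ ≤ 1
    simpa using ha
  mem_or_inv_mem' := by
    rintro ⟨a⟩
    change (∀ᶠ j in (U : Filter ι), ‖a j‖ ≤ 1) ∨ (∀ᶠ j in (U : Filter ι), ‖(a j)⁻¹‖ ≤ 1)
    rw [← Ultrafilter.eventually_or]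
    refine Eventually.of_forall fun j ↦ ?_
    rw [norm_inv]
    rcases le_total ‖a j‖ 1 with h | h
    · exact Or.inl h
    · exact Or.inr (inv_le_one_of_one_le₀ h)

/-- The valuation on an ultrapower of the `p`-adic numbers. -/
noncomputable def germValuation :
    Valuation ((U : Filter ι).Germ ℚ_[p]) (germValuationSubring U p).ValueGroup :=
  (germValuationSubring U p).valuation

variable {U p}

theorem germValuation_le_iff (f g : ι → ℚ_[p]) :
    germValuation U p (f : (U : Filter ι).Germ ℚ_[p]) ≤ germValuation U p g ↔
      ∀ᶠ j in U, ‖f j‖ ≤ ‖g j‖ := by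
  by_cases hg : (g : (U : Filter ι).Germ ℚ_[p]) = 0
  · have hg' : ∀ᶠ j in U, g j = 0 := Germ.coe_eq.1 hg
    rw [hg, map_zero, le_zero_iff, (germValuation U p).zero_iff]
    constructor
    · intro hf
      have hf' : ∀ᶠ j in U, f j = 0 := Germ.coe_eq.1 hf
      filter_upwards [hg', hf'] with j h1 h2
      rw [h1, h2]
    · intro h
      refine Germ.coe_eq.2 ?_
      filter_upwards [hg', h] with j h1 h2
      simpa [h1] using h2
  · have hg' : ∀ᶠ j in U, g j ≠ 0 := by
      rw [Ultrafilter.eventually_not]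
      exact fun h ↦ hg (Germ.coe_eq.2 h)
    rw [← div_le_one₀ (zero_lt_iff.2 ((germValuation U p).ne_zero_iff.2 hg)), ← map_div₀]
    refine ((germValuationSubring U p).valuation_le_one_iff _).trans ?_
    change (∀ᶠ j in U, ‖f j / g j‖ ≤ 1) ↔ _
    refine eventually_congr ?_
    filter_upwards [hg'] with j hj
    rw [norm_div, div_le_one₀ (norm_pos_iff.2 hj)]

theorem germValuation_lt_iff (f g : ι → ℚ_[p]) :
    germValuation U p (f : (U : Filter ι).Germ ℚ_[p]) < germValuation U p g ↔
      ∀ᶠ j in U, ‖f j‖ < ‖g j‖ := by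
  rw [← not_le, germValuation_le_iff, ← Ultrafilter.eventually_not]
  simp only [not_le]

theorem germValuation_le_one_iff (f : ι → ℚ_[p]) :
    germValuation U p (f : (U : Filter ι).Germ ℚ_[p]) ≤ 1 ↔ ∀ᶠ j in U, ‖f j‖ ≤ 1 := by
  rw [← map_one (germValuation U p), ← Germ.coe_one, germValuation_le_iff]
  simp

theorem germValuation_lt_one_iff (f : ι → ℚ_[p]) :
    germValuation U p (f : (U : Filter ι).Germ ℚ_[p]) < 1 ↔ ∀ᶠ j in U, ‖f j‖ < 1 := by
  rw [← map_one (germValuation U p), ← Germ.coe_one, germValuation_lt_iff]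
  simp

theorem germValuation_eq_one_iff (f : ι → ℚ_[p]) :
    germValuation U p (f : (U : Filter ι).Germ ℚ_[p]) = 1 ↔ ∀ᶠ j in U, ‖f j‖ = 1 := by
  have h := germValuation_le_iff (U := U) 1 f
  rw [Germ.coe_one, map_one] at h
  rw [le_antisymm_iff, germValuation_le_one_iff, h, ← eventually_and]
  simp [le_antisymm_iff]

theorem Germ.natCast_eq_coe (n : ℕ) :
    (n : (U : Filter ι).Germ ℚ_[p]) = ((fun _ ↦ n : ι → ℚ_[p]) : (U : Filter ι).Germ ℚ_[p]) :=
  rfl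

theorem Ultrafilter.exists_of_eventually_exists_lt {B : ℕ} {P : ι → ℕ → Prop}
    (h : ∀ᶠ j in U, ∃ q < B, P j q) : ∃ q, ∀ᶠ j in U, P j q := by
  by_contra! hc
  have h1 : ∀ᶠ j in U, ∀ q ∈ Finset.range B, ¬ P j q := by
    rw [Filter.eventually_all_finset]
    exact fun q _ ↦ hc q
  obtain ⟨j, ⟨q, hq, hP⟩, hj⟩ := (h.and h1).exists
  exact hj q (Finset.mem_range.2 hq) hP

theorem Germ.exists_coe_of_eventually {ι β : Type*} [Inhabited β] {𝓕 : Filter ι} {P : ι → β → Prop}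
    (h : ∀ᶠ j in 𝓕, ∃ y, P j y) : ∃ f : ι → β, ∀ᶠ j in 𝓕, P j (f j) := by
  classical
  refine ⟨fun j ↦ if h : ∃ y, P j y then h.choose else default, ?_⟩
  filter_upwards [h] with j hj
  rw [dif_pos hj]
  exact hj.choose_spec

theorem germ_exists_root (g : ((U : Filter ι).Germ ℚ_[p])[X])
    (h0 : germValuation U p (g.coeff 0) ≤ 1) (h1 : g.coeff 1 = 1)
    (h2 : ∀ i, 2 ≤ i → germValuation U p (g.coeff i) < 1) :
    ∃ y, germValuation U p y ≤ 1 ∧ g.eval y = 0 := by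
  obtain ⟨G, rfl⟩ := Polynomial.map_surjective
    (Germ.coeRingHom (U : Filter ι) : (ι → ℚ_[p]) →+* (U : Filter ι).Germ ℚ_[p])
    (fun x ↦ Quotient.inductionOn' x fun f ↦ ⟨f, rfl⟩) g
  simp only [coeff_map] at h0 h1 h2
  have h0' : ∀ᶠ j in U, ‖G.coeff 0 j‖ ≤ 1 := (germValuation_le_one_iff _).1 h0
  have h1' : ∀ᶠ j in U, G.coeff 1 j = 1 := Germ.coe_eq.1 h1
  have h2' : ∀ᶠ j in U, ∀ i, 2 ≤ i → ‖G.coeff i j‖ < 1 := by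
    have : ∀ᶠ j in U, ∀ i ∈ Finset.range (G.natDegree + 1), 2 ≤ i → ‖G.coeff i j‖ < 1 := by
      rw [Filter.eventually_all_finset]
      intro i _
      by_cases hi : 2 ≤ i
      · filter_upwards [(germValuation_lt_one_iff _).1 (h2 i hi)] with j hj _ using hj
      · exact Eventually.of_forall fun j hj ↦ absurd hj hi
    filter_upwards [this] with j hj i hi
    by_cases hd : i < G.natDegree + 1
    · exact hj i (Finset.mem_range.2 hd) hi
    · rw [coeff_eq_zero_of_natDegree_lt (by omega)]
      simp
  have hex : ∀ᶠ j in U, ∃ y : ℚ_[p], ‖y‖ ≤ 1 ∧ (G.map (Pi.evalRingHom _ j)).eval y = 0 := by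
    filter_upwards [h0', h1', h2'] with j h0 h1 h2
    exact Padic.exists_root_of_coeff (by simpa using h0) (by simpa using h1)
      (by simpa using h2)
  obtain ⟨y, hy⟩ := Germ.exists_coe_of_eventually hex
  refine ⟨(y : (U : Filter ι).Germ ℚ_[p]),
    (germValuation_le_one_iff _).2 (hy.mono fun j h ↦ h.1), ?_⟩
  have he : (G.map (Germ.coeRingHom (U : Filter ι))).eval (y : (U : Filter ι).Germ ℚ_[p]) =
      Germ.coeRingHom (U : Filter ι) (G.eval y) := by
    rw [eval_map]
    exact Polynomial.eval₂_at_apply (Germ.coeRingHom (U : Filter ι)) y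
  rw [he]
  refine Germ.coe_eq.2 (hy.mono fun j h ↦ ?_)
  have := h.2
  rw [eval_map] at this
  have h' := Polynomial.eval₂_at_apply (p := G) (Pi.evalRingHom (fun _ : ι ↦ ℚ_[p]) j) y
  exact h'.symm.trans this

theorem padicLike_germValuation : PadicLike p (germValuation U p) where
  charZero := by
    refine ⟨fun a b hab ↦ ?_⟩
    rw [Germ.natCast_eq_coe, Germ.natCast_eq_coe] at hab
    obtain ⟨j, hj⟩ := (Germ.coe_eq.1 hab).exists
    exact Nat.cast_injective (R := ℚ_[p]) hj
  lt_one := by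
    rw [Germ.natCast_eq_coe, germValuation_lt_one_iff]
    exact Eventually.of_forall fun _ ↦ Padic.norm_p_lt_one
  le_of_lt_one := by
    rintro ⟨x⟩ hx
    refine (germValuation_le_iff _ _).2 ?_
    filter_upwards [(germValuation_lt_one_iff x).1 hx] with j hj
    exact Padic.norm_le_norm_p_of_lt_one hj
  exists_natCast_sub_lt := by
    rintro ⟨x⟩ hx
    have : ∀ᶠ j in U, ∃ n < p, ‖x j - n‖ < 1 := by
      filter_upwards [(germValuation_le_one_iff x).1 hx] with j hj
      exact Padic.exists_natCast_lt_norm_sub_lt hj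
    obtain ⟨n, hn⟩ := Ultrafilter.exists_of_eventually_exists_lt this
    exact ⟨n, (germValuation_lt_one_iff _).2 hn⟩
  exists_pow_le_natCast := by
    intro n hn
    have hn' : (n : ℚ_[p]) ≠ 0 := by exact_mod_cast hn
    obtain ⟨C, hC⟩ := Padic.exists_pow_norm_p_lt (p := p) (norm_pos_iff.2 hn')
    refine ⟨C, ?_⟩
    rw [← map_pow]
    refine (germValuation_le_iff (fun _ ↦ (p : ℚ_[p]) ^ C) _).2 (Eventually.of_forall fun _ ↦ ?_)
    rw [norm_pow]
    exact hC.le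
  exists_root := germ_exists_root
  exists_one_add_eq_pow := by
    intro n hn
    have hn' : (n : ℚ_[p]) ≠ 0 := by exact_mod_cast hn
    obtain ⟨N, hN⟩ := Padic.exists_pow_norm_p_lt (p := p) (pow_pos (norm_pos_iff.2 hn') 2)
    refine ⟨N, ?_⟩
    rintro ⟨u⟩ hu
    rw [← map_pow] at hu
    have hu' := (germValuation_le_iff u (fun _ ↦ (p : ℚ_[p]) ^ N)).1 hu
    have : ∀ᶠ j in U, ∃ w : ℚ_[p], 1 + u j = w ^ n := by
      filter_upwards [hu'] with j hj
      exact Padic.exists_one_add_eq_pow (hj.trans_lt (by rwa [norm_pow]))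
    obtain ⟨w, hw⟩ := Germ.exists_coe_of_eventually this
    exact ⟨w, Germ.coe_eq.2 hw⟩
  exists_unit_eq := by
    rintro n hn ⟨x⟩ hx
    obtain ⟨B, hB⟩ := Padic.exists_unit_eq (p := p) hn
    have : ∀ᶠ j in U, ∃ q < B, q ≠ 0 ∧ ∃ w : ℚ_[p], ‖w‖ = 1 ∧ x j = q * w ^ n := by
      filter_upwards [(germValuation_eq_one_iff x).1 hx] with j hj using hB _ hj
    obtain ⟨q, hq⟩ := Ultrafilter.exists_of_eventually_exists_lt this
    obtain ⟨w, hw⟩ := Germ.exists_coe_of_eventually (hq.mono fun j h ↦ h.2)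
    exact ⟨q, hq.exists.choose_spec.1, w, (germValuation_eq_one_iff w).2 (hw.mono fun _ h ↦ h.1),
      Germ.coe_eq.2 (hw.mono fun _ h ↦ h.2)⟩
  exists_eq := by
    rintro n hn ⟨x⟩ hx
    obtain ⟨B, hB⟩ := Padic.exists_eq (p := p) hn
    have hx' : ∀ᶠ j in U, x j ≠ 0 := Ultrafilter.eventually_not.2 fun h ↦ hx (Germ.coe_eq.2 h)
    have : ∀ᶠ j in U, ∃ q < B, q ≠ 0 ∧ ∃ w : ℚ_[p], x j = q * w ^ n := by
      filter_upwards [hx'] with j hj using hB _ hj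
    obtain ⟨q, hq⟩ := Ultrafilter.exists_of_eventually_exists_lt this
    obtain ⟨w, hw⟩ := Germ.exists_coe_of_eventually (hq.mono fun j h ↦ h.2)
    exact ⟨q, hq.exists.choose_spec.1, w, Germ.coe_eq.2 hw⟩
  natCast_eq_pow_iff := by
    intro n q hn
    constructor
    · rintro ⟨⟨w⟩, hw⟩
      obtain ⟨j, hj⟩ := (Germ.coe_eq.1 hw : ∀ᶠ j in U, (q : ℚ_[p]) = w j ^ n).exists
      exact ⟨w j, hj⟩
    · rintro ⟨w, hw⟩
      exact ⟨((fun _ ↦ w : ι → ℚ_[p]) : (U : Filter ι).Germ ℚ_[p]),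
        Germ.coe_eq.2 (Eventually.of_forall fun _ ↦ hw)⟩
  le_one_iff := by
    rintro ⟨x⟩
    refine (germValuation_le_one_iff x).trans ?_
    constructor
    · intro h
      obtain ⟨y, hy⟩ := Germ.exists_coe_of_eventually
        (h.mono fun j hj ↦ (Padic.norm_le_one_iff_exists (x j)).1 hj)
      exact ⟨y, Germ.coe_eq.2 hy⟩
    · rintro ⟨⟨y⟩, hy⟩
      have : ∀ᶠ j in U, y j ^ (p + 1) = 1 + p * x j ^ (p + 1) := Germ.coe_eq.1 hy
      filter_upwards [this] with j hj using (Padic.norm_le_one_iff_exists (x j)).2 ⟨_, hj⟩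

end GermValuation

section ModelTheory

universe v

theorem FirstOrder.Language.ElementarilyEquivalent.exists_realize {𝓛 : Language} {M N α : Type*}
    [𝓛.Structure M] [𝓛.Structure N] [Nonempty N] (h : M ≅[𝓛] N) (φ : 𝓛.Formula α) {v : α → M}
    (hv : φ.Realize v) : ∃ w : α → N, φ.Realize w := by
  classical
  have h1 : φ.exClosure.Realize M := by
    rw [Language.Formula.realize_exClosure]
    exact ⟨fun a ↦ v a,
      (Language.BoundedFormula.realize_restrictFreeVar (f := id) v fun _ ↦ rfl).2 hv⟩
  have h2 : φ.exClosure.Realize N := (Language.elementarilyEquivalent_iff.1 h _).1 h1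
  rw [Language.Formula.realize_exClosure] at h2
  obtain ⟨w, hw⟩ := h2
  refine ⟨fun a ↦ if ha : a ∈ φ.freeVarFinset then w ⟨a, ha⟩ else Classical.arbitrary N, ?_⟩
  refine (Language.BoundedFormula.realize_restrictFreeVar _ fun a ↦ ?_).1 hw
  simp

/-- An ultrapower of the `p`-adic numbers is elementarily equivalent to the `p`-adic numbers. -/
theorem elemEquivToQp_germ (p : ℕ) [Fact p.Prime] {ι : Type*} (U : Ultrafilter ι) :
    ElemEquivToQp p ((U : Filter ι).Germ ℚ_[p]) := by
  let _ := Ring.compatibleRingOfRing ((U : Filter ι).Germ ℚ_[p])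
  let _ := Ring.compatibleRingOfRing ℚ_[p]
  have h1 : (U : Filter ι).Product (fun _ ↦ ℚ_[p]) ≅[Language.ring] ℚ_[p] := by
    rw [Language.elementarilyEquivalent_iff]
    intro φ
    rw [Language.Ultraproduct.sentence_realize]
    simp
  let e : (U : Filter ι).Product (fun _ ↦ ℚ_[p]) ≃[Language.ring] (U : Filter ι).Germ ℚ_[p] :=
    { toFun := Quotient.map' id fun _ _ h ↦ h
      invFun := Quotient.map' id fun _ _ h ↦ h
      left_inv := by rintro ⟨a⟩; rfl
      right_inv := by rintro ⟨a⟩; rfl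
      map_fun' := by
        intro n f x
        obtain ⟨y, rfl⟩ : ∃ y : Fin n → ι → ℚ_[p],
            x = fun i ↦ ((y i : ι → ℚ_[p]) : (U : Filter ι).Product (fun _ ↦ ℚ_[p])) :=
          ⟨fun i ↦ (x i).out, funext fun i ↦ (Quotient.out_eq (x i)).symm⟩
        have := Language.Ultraproduct.funMap_cast (u := U) f y
        refine (congrArg _ this).trans ?_
        cases f <;> rfl
      map_rel' := by
        intro n r
        cases r }
  exact (Language.StrongHomClass.elementarilyEquivalent e).symm.trans h1

/-- The `m`-th power of a term in the language of rings. -/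
def ringTermPow {α : Type*} (t : Language.ring.Term α) : ℕ → Language.ring.Term α
  | 0 => 1
  | m + 1 => ringTermPow t m * t

theorem realize_ringTermPow {α R : Type*} [CommRing R] [Ring.CompatibleRing R]
    (t : Language.ring.Term α) (m : ℕ) (v : α → R) :
    (ringTermPow t m).realize v = t.realize v ^ m := by
  induction m with
  | zero => simp [ringTermPow]
  | succ m ih => simp [ringTermPow, ih, pow_succ]

/-- The formula expressing that the variable `x` is an `m`-th power. -/
noncomputable def isPowFormula {α : Type*} (m : ℕ) (x : α) : Language.ring.Formula α :=
  Language.Formula.iExs Unit (Language.Term.equal (Language.Term.var (Sum.inl x))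
    (ringTermPow (Language.Term.var (Sum.inr ())) m))

theorem realize_isPowFormula {α R : Type*} [CommRing R] [Ring.CompatibleRing R]
    (m : ℕ) (x : α) (v : α → R) : (isPowFormula m x).Realize v ↔ ∃ y, v x = y ^ m := by
  rw [isPowFormula, Language.Formula.realize_iExs]
  simp only [Language.Formula.realize_equal, realize_ringTermPow, Language.Term.realize_var,
    Sum.elim_inl, Sum.elim_inr]
  exact ⟨fun ⟨i, h⟩ ↦ ⟨_, h⟩, fun ⟨y, h⟩ ↦ ⟨fun _ ↦ y, h⟩⟩

/-- A field embedded in a field elementarily equivalent to the `p`-adic numbers embeds in an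
ultrapower of the `p`-adic numbers, with the same elements becoming powers. -/
theorem ElemEquivToQp.exists_germ_embedding {p : ℕ} [Fact p.Prime] {L : Type v} {K : Type*}
    [Field L] [Field K] (hK : ElemEquivToQp p K) (f : L →+* K) :
    ∃ (ι : Type v) (U : Ultrafilter ι) (g : L →+* (U : Filter ι).Germ ℚ_[p]),
      ∀ m x, (∃ y, g x = y ^ m) ↔ ∃ y, f x = y ^ m := by
  let _ := Ring.compatibleRingOfRing K
  let _ := Ring.compatibleRingOfRing ℚ_[p]
  let C := {φ : Language.ring.Formula L // φ.Realize f}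
  have hex : ∀ Δ : Finset C, ∃ w : L → ℚ_[p], ∀ φ ∈ Δ, φ.1.Realize w := by
    intro Δ
    obtain ⟨w, hw⟩ := Language.ElementarilyEquivalent.exists_realize hK
      (Language.Formula.iInf fun φ : Δ ↦ φ.1.1) (v := f)
      (Language.Formula.realize_iInf.2 fun φ ↦ φ.1.2)
    exact ⟨w, fun φ hφ ↦ Language.Formula.realize_iInf.1 hw ⟨φ, hφ⟩⟩
  choose e he using hex
  let U : Ultrafilter (Finset C) := Ultrafilter.of atTop
  have hev : ∀ φ : Language.ring.Formula L, φ.Realize f → ∀ᶠ Δ in U, φ.Realize (e Δ) := by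
    intro φ hφ
    have : ∀ᶠ Δ : Finset C in atTop, {⟨φ, hφ⟩} ⊆ Δ := eventually_ge_atTop ({⟨φ, hφ⟩} : Finset C)
    filter_upwards [Ultrafilter.of_le _ this] with Δ hΔ
    exact he Δ ⟨φ, hφ⟩ (hΔ (Finset.mem_singleton_self _))
  let G : L → (U : Filter (Finset C)).Germ ℚ_[p] := fun x ↦
    ((fun Δ ↦ e Δ x : Finset C → ℚ_[p]) : (U : Filter (Finset C)).Germ ℚ_[p])
  refine ⟨Finset C, U, ⟨⟨⟨G, ?_⟩, ?_⟩, ?_, ?_⟩, ?_⟩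
  · refine Germ.coe_eq.2 ?_
    filter_upwards [hev (Language.Term.equal (Language.Term.var 1) 1) (by simp)] with Δ hΔ
    simpa using hΔ
  · intro x y
    refine Germ.coe_eq.2 ?_
    filter_upwards [hev (Language.Term.equal (Language.Term.var (x * y))
      (Language.Term.var x * Language.Term.var y)) (by simp)] with Δ hΔ
    simpa using hΔ
  · refine Germ.coe_eq.2 ?_
    filter_upwards [hev (Language.Term.equal (Language.Term.var 0) 0) (by simp)] with Δ hΔ
    simpa using hΔ
  · intro x y
    refine Germ.coe_eq.2 ?_
    filter_upwards [hev (Language.Term.equal (Language.Term.var (x + y))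
      (Language.Term.var x + Language.Term.var y)) (by simp)] with Δ hΔ
    simpa using hΔ
  · intro m x
    constructor
    · rintro ⟨⟨y⟩, hy⟩
      by_contra hx
      have h1 := hev (isPowFormula m x).not
        (by rw [Language.Formula.realize_not, realize_isPowFormula]; exact hx)
      have h2 : ∀ᶠ Δ in U, e Δ x = y Δ ^ m := Germ.coe_eq.1 hy
      obtain ⟨Δ, h1, h2⟩ := (h1.and h2).exists
      rw [Language.Formula.realize_not, realize_isPowFormula] at h1
      exact h1 ⟨_, h2⟩
    · intro hx
      have h1 := hev (isPowFormula m x) ((realize_isPowFormula m x f).2 hx)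
      simp only [realize_isPowFormula] at h1
      obtain ⟨y, hy⟩ := Germ.exists_coe_of_eventually h1
      exact ⟨y, Germ.coe_eq.2 hy⟩

end ModelTheory

section PowRelation

universe v

variable {K₁ K₂ : Type v} [Field K₁] [Field K₂]

/-- A ring of pairs in which paired nonzero elements lie in the same power classes. -/
def IsPowRelation (G : Subring (K₁ × K₂)) : Prop :=
  ∀ x ∈ G, x = 0 ∨ ∀ n, n ≠ 0 → SamePowClass n x.1 x.2

theorem isPowRelation_range {F : Type*} [Field F] {i₁ : F →+* K₁} {i₂ : F →+* K₂}
    (hc : PowCompat i₁ i₂) : IsPowRelation (i₁.prod i₂).range := by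
  rintro _ ⟨a, rfl⟩
  by_cases ha : a = 0
  · left; simp [ha]
  · exact Or.inr (hc a ha)

theorem IsAdjoinable.isPowRelation_range {F : Type*} [Field F] {i₁ : F →+* K₁} {i₂ : F →+* K₂}
    {z₁ : K₁} {z₂ : K₂} (h : IsAdjoinable i₁ i₂ z₁ z₂) :
    IsPowRelation ((eval₂RingHom i₁ z₁).prod (eval₂RingHom i₂ z₂)).range := by
  rintro _ ⟨g, rfl⟩
  rcases h g with ⟨h1, h2⟩ | h
  · left; simp [h1, h2]
  · exact Or.inr h

theorem IsPowRelation.fst_eq_zero [CharZero K₁] {G : Subring (K₁ × K₂)} (hG : IsPowRelation G)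
    {x : K₁ × K₂} (hx : x ∈ G) (h : x.1 = 0) : x = 0 :=
  (hG x hx).resolve_right fun h' ↦ (h' 1 one_ne_zero).left_ne_zero h

theorem IsPowRelation.snd_eq_zero [CharZero K₂] {G : Subring (K₁ × K₂)} (hG : IsPowRelation G)
    {x : K₁ × K₂} (hx : x ∈ G) (h : x.2 = 0) : x = 0 :=
  (hG x hx).resolve_right fun h' ↦ (h' 1 one_ne_zero).right_ne_zero h

theorem IsPowRelation.snd_unique [CharZero K₁] {G : Subring (K₁ × K₂)} (hG : IsPowRelation G)
    {a : K₁} {b b' : K₂}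
    (h : (a, b) ∈ G) (h' : (a, b') ∈ G) : b = b' := by
  have := hG.fst_eq_zero (G.sub_mem h h') (by simp)
  simpa [sub_eq_zero] using this

variable [CharZero K₁] [CharZero K₂]

/-- The ring of pairs is contained in the graph of a compatible pair of field embeddings. -/
theorem IsPowRelation.exists_field {G : Subring (K₁ × K₂)} (hG : IsPowRelation G) :
    ∃ (F : Type v) (_ : Field F) (i₁ : F →+* K₁) (i₂ : F →+* K₂), PowCompat i₁ i₂ ∧
      G ≤ (i₁.prod i₂).range := by
  let j₁ : G →+* K₁ := (RingHom.fst K₁ K₂).comp G.subtype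
  let j₂ : G →+* K₂ := (RingHom.snd K₁ K₂).comp G.subtype
  have hj₁ : Function.Injective j₁ := by
    rw [injective_iff_map_eq_zero]
    exact fun x hx ↦ Subtype.ext (hG.fst_eq_zero x.2 hx)
  have hj₂ : Function.Injective j₂ := by
    rw [injective_iff_map_eq_zero]
    exact fun x hx ↦ Subtype.ext (hG.snd_eq_zero x.2 hx)
  have : IsDomain G := hj₁.isDomain j₁
  refine ⟨FractionRing G, inferInstance, IsFractionRing.lift hj₁, IsFractionRing.lift hj₂, ?_, ?_⟩
  · intro a ha n hn
    obtain ⟨x, y, hy, rfl⟩ := IsFractionRing.div_surjective (A := G) a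
    have hy0 : y ≠ 0 := nonZeroDivisors.ne_zero hy
    have hx0 : x ≠ 0 := by rintro rfl; simp at ha
    have key : ∀ x : G, x ≠ 0 → SamePowClass n (j₁ x) (j₂ x) := fun x hx ↦
      (hG x x.2).resolve_left (fun h ↦ hx (Subtype.ext h)) n hn
    rw [map_div₀, map_div₀]
    simp only [IsFractionRing.lift_algebraMap, div_eq_mul_inv]
    exact (key x hx0).mul ((key y hy0).inv hn)
  · intro x hx
    exact ⟨algebraMap G _ ⟨x, hx⟩, by
      rw [RingHom.prod_apply, IsFractionRing.lift_algebraMap, IsFractionRing.lift_algebraMap]; rfl⟩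

theorem IsPowRelation.exists_maximal {G : Subring (K₁ × K₂)} (hG : IsPowRelation G) :
    ∃ (F : Type v) (_ : Field F) (i₁ : F →+* K₁) (i₂ : F →+* K₂), PowCompat i₁ i₂ ∧
      G ≤ (i₁.prod i₂).range ∧ ∀ z z', IsAdjoinable i₁ i₂ z z' → ∃ a, i₁ a = z := by
  obtain ⟨M, hGM, hM⟩ := zorn_le_nonempty₀ {G : Subring (K₁ × K₂) | IsPowRelation G}
    (fun c hc hchain y hy ↦ by
      have hdir := hchain.directedOn
      refine ⟨sSup c, fun x hx ↦ ?_, fun z hz ↦ le_sSup hz⟩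
      obtain ⟨s, hs, hxs⟩ := (Subring.mem_sSup_of_directedOn ⟨y, hy⟩ hdir).1 hx
      exact hc hs x hxs) G hG
  obtain ⟨F, hF, i₁, i₂, hc, hle⟩ := IsPowRelation.exists_field hM.prop
  refine ⟨F, hF, i₁, i₂, hc, hGM.trans hle, fun z z' hz ↦ ?_⟩
  have hle' : (i₁.prod i₂).range ≤ ((eval₂RingHom i₁ z).prod (eval₂RingHom i₂ z')).range := by
    rintro _ ⟨a, rfl⟩
    exact ⟨C a, by simp⟩
  have hmem : (z, z') ∈ ((eval₂RingHom i₁ z).prod (eval₂RingHom i₂ z')).range := ⟨X, by simp⟩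
  obtain ⟨a, ha⟩ := hle (hM.le_of_ge hz.isPowRelation_range (hle.trans hle') hmem)
  exact ⟨a, congrArg Prod.fst ha⟩

end PowRelation

theorem SamePowClass.exists_eq_of_eq {p : ℕ} [Fact p.Prime] {K₁ K₂ Γ₁ Γ₂ : Type*} [Field K₁]
    [Field K₂] [LinearOrderedCommGroupWithZero Γ₁] [LinearOrderedCommGroupWithZero Γ₂]
    {v₁ : Valuation K₁ Γ₁} {v₂ : Valuation K₂ Γ₂} (h₁ : PadicLike p v₁) (h₂ : PadicLike p v₂)
    {n : ℕ} (hn : n ≠ 0) {a s : K₁} {b : K₂} (h : SamePowClass n a b) {q : ℕ} (hq : q ≠ 0)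
    (ha : a = q * s ^ n) : ∃ t, t ≠ 0 ∧ b = q * t ^ n := by
  have := h₁.charZero
  have := h₂.charZero
  have hq1 : (q : K₁) ≠ 0 := by exact_mod_cast hq
  have hq2 : (q : K₂) ≠ 0 := by exact_mod_cast hq
  have hqq : SamePowClass n (q : K₁) (q : K₂) :=
    ⟨q, hq, 1, 1, one_ne_zero, one_ne_zero, by simp, by simp⟩
  obtain ⟨t, ht⟩ := (SamePowClass.isPow_iff h₁ h₂ hn ((hqq.inv hn).mul h)).1
    ⟨s, by rw [ha, inv_mul_cancel_left₀ hq1]⟩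
  have hb : b = q * t ^ n := by rw [← ht, mul_inv_cancel_left₀ hq2]
  refine ⟨t, ?_, hb⟩
  rintro rfl
  exact h.right_ne_zero (by rw [hb, zero_pow hn, mul_zero])

section IteratedGerm

variable {κ ι β : Type*} (V : Ultrafilter κ) (U : Ultrafilter ι)

/-- The iterated ultrafilter on a product. -/
def Ultrafilter.iterate : Ultrafilter (κ × ι) := V.bind fun y ↦ U.map (Prod.mk y)

theorem Ultrafilter.eventually_iterate {P : κ × ι → Prop} :
    (∀ᶠ x in V.iterate U, P x) ↔ ∀ᶠ y in V, ∀ᶠ j in U, P (y, j) :=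
  Iff.rfl

/-- A family representing a germ. -/
noncomputable def Filter.Germ.rep {l : Filter ι} (a : l.Germ β) : ι → β := Quotient.out a

theorem Filter.Germ.coe_rep {l : Filter ι} (a : l.Germ β) : (a.rep : l.Germ β) = a :=
  Quotient.out_eq' a

theorem Filter.Germ.eventually_rep_mul [Mul β] {l : Filter ι} (a b : l.Germ β) :
    ∀ᶠ j in l, (a * b).rep j = a.rep j * b.rep j := by
  have h : ((a * b).rep : l.Germ β) = (a.rep * b.rep : ι → β) := by
    rw [Germ.coe_mul, Germ.coe_rep, Germ.coe_rep, Germ.coe_rep]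
  exact Germ.coe_eq.1 h

theorem Filter.Germ.eventually_rep_add [Add β] {l : Filter ι} (a b : l.Germ β) :
    ∀ᶠ j in l, (a + b).rep j = a.rep j + b.rep j := by
  have h : ((a + b).rep : l.Germ β) = (a.rep + b.rep : ι → β) := by
    rw [Germ.coe_add, Germ.coe_rep, Germ.coe_rep, Germ.coe_rep]
  exact Germ.coe_eq.1 h

theorem Filter.Germ.eventually_rep_one [One β] (l : Filter ι) :
    ∀ᶠ j in l, (1 : l.Germ β).rep j = 1 :=
  Germ.coe_eq.1 (Germ.coe_rep (1 : l.Germ β))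

theorem Filter.Germ.eventually_rep_zero [Zero β] (l : Filter ι) :
    ∀ᶠ j in l, (0 : l.Germ β).rep j = 0 :=
  Germ.coe_eq.1 (Germ.coe_rep (0 : l.Germ β))

variable [Field β]

/-- A family of germs gives a germ along the iterated ultrafilter. -/
noncomputable def germFlatten :
    (κ → (U : Filter ι).Germ β) →+* (V.iterate U : Filter (κ × ι)).Germ β where
  toFun φ := ((fun x ↦ (φ x.1).rep x.2 : κ × ι → β) : (V.iterate U : Filter (κ × ι)).Germ β)
  map_one' := by
    refine Germ.coe_eq.2 ((Ultrafilter.eventually_iterate V U).2 (Eventually.of_forall fun y ↦ ?_))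
    exact Germ.eventually_rep_one _
  map_zero' := by
    refine Germ.coe_eq.2 ((Ultrafilter.eventually_iterate V U).2 (Eventually.of_forall fun y ↦ ?_))
    exact Germ.eventually_rep_zero _
  map_mul' φ ψ := by
    refine Germ.coe_eq.2 ((Ultrafilter.eventually_iterate V U).2 (Eventually.of_forall fun y ↦ ?_))
    exact Germ.eventually_rep_mul (φ y) (ψ y)
  map_add' φ ψ := by
    refine Germ.coe_eq.2 ((Ultrafilter.eventually_iterate V U).2 (Eventually.of_forall fun y ↦ ?_))
    exact Germ.eventually_rep_add (φ y) (ψ y)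

variable {V U}

theorem germFlatten_congr {φ ψ : κ → (U : Filter ι).Germ β} (h : ∀ᶠ y in V, φ y = ψ y) :
    germFlatten V U φ = germFlatten V U ψ := by
  refine Germ.coe_eq.2 ((Ultrafilter.eventually_iterate V U).2 (h.mono fun y hy ↦ ?_))
  exact Eventually.of_forall fun j ↦ by simp only [hy]

theorem germFlatten_ne_zero {φ : κ → (U : Filter ι).Germ β} (h : ∀ᶠ y in V, φ y ≠ 0) :
    germFlatten V U φ ≠ 0 := by
  intro h0
  have h1 : germFlatten V U (φ * φ⁻¹) = germFlatten V U 1 :=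
    germFlatten_congr (h.mono fun y hy ↦ mul_inv_cancel₀ hy)
  rw [map_mul, h0, zero_mul, map_one] at h1
  exact zero_ne_one h1

end IteratedGerm

section Extension

variable {p : ℕ} [Fact p.Prime]

theorem Approximates.exists_isAdjoinable {F K₁ Γ₁ ι : Type*} [Field F] [Field K₁]
    [LinearOrderedCommGroupWithZero Γ₁] {v₁ : Valuation K₁ Γ₁} (h₁ : PadicLike p v₁)
    {U : Ultrafilter ι} {i₁ : F →+* K₁} {i₂ : F →+* (U : Filter ι).Germ ℚ_[p]}
    (hc : PowCompat i₁ i₂) {z : K₁} {V : Ultrafilter F} (hz : Approximates i₁ z V) :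
    IsAdjoinable i₁ (((germFlatten V U).comp (Pi.constRingHom F _)).comp i₂) z
      (germFlatten V U i₂) := by
  intro g
  by_cases hg : g = 0
  · left; simp [hg]
  refine Or.inr fun n hn ↦ ?_
  have heval : g.eval₂ (((germFlatten V U).comp (Pi.constRingHom F _)).comp i₂)
      (germFlatten V U i₂) = germFlatten V U (fun y ↦ i₂ (g.eval y)) := by
    rw [RingHom.comp_assoc, ← hom_eval₂]
    congr 1
    funext y
    have := hom_eval₂ g ((Pi.constRingHom F ((U : Filter ι).Germ ℚ_[p])).comp i₂)
      (Pi.evalRingHom (fun _ ↦ (U : Filter ι).Germ ℚ_[p]) y) i₂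
    refine this.trans ?_
    rw [← eval₂_at_apply]
    rfl
  obtain ⟨y₀, hy₀, w₀, hw₀, hzw₀⟩ := (hz g hg n hn).exists
  obtain ⟨q, hq, s₀, -, hs₀, -, hqs, -⟩ := hc _ hy₀ n hn
  have hzq : g.eval₂ i₁ z = q * (s₀ * w₀) ^ n := by rw [hzw₀, hqs, mul_pow, mul_assoc]
  have hex : ∀ᶠ y in V, ∃ t : (U : Filter ι).Germ ℚ_[p], t ≠ 0 ∧ i₂ (g.eval y) = q * t ^ n := by
    filter_upwards [hz g hg n hn] with y hy
    obtain ⟨hy, w, hw, hzw⟩ := hy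
    refine SamePowClass.exists_eq_of_eq h₁ padicLike_germValuation hn (hc _ hy n hn) hq
      (s := s₀ * w₀ / w) ?_
    rw [div_pow, ← mul_div_assoc, ← hzq, hzw, mul_div_cancel_right₀ _ (pow_ne_zero n hw)]
  obtain ⟨t, ht⟩ := Germ.exists_coe_of_eventually hex
  refine ⟨q, hq, s₀ * w₀, germFlatten V U t, mul_ne_zero hs₀ hw₀,
    germFlatten_ne_zero (ht.mono fun y h ↦ h.1), hzq, ?_⟩
  rw [heval, germFlatten_congr (ψ := (q : F → (U : Filter ι).Germ ℚ_[p]) * t ^ n)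
    (ht.mono fun y h ↦ h.2), map_mul, map_pow, map_natCast]

universe v

theorem IsPowRelation.exists_extension {K₁ Γ₁ : Type v} [Field K₁]
    [LinearOrderedCommGroupWithZero Γ₁] {v₁ : Valuation K₁ Γ₁} (h₁ : PadicLike p v₁) {ι : Type v}
    {U : Ultrafilter ι} {G : Subring (K₁ × (U : Filter ι).Germ ℚ_[p])} (hG : IsPowRelation G)
    (x : K₁) : ∃ (ι' : Type v) (U' : Ultrafilter ι')
      (h : (U : Filter ι).Germ ℚ_[p] →+* (U' : Filter ι').Germ ℚ_[p])
      (G' : Subring (K₁ × (U' : Filter ι').Germ ℚ_[p])), IsPowRelation G' ∧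
      (∀ a b, (a, b) ∈ G → (a, h b) ∈ G') ∧ ∃ y, (x, y) ∈ G' := by
  have := h₁.charZero
  have hchar : ∀ {ι : Type v} (U : Ultrafilter ι), CharZero ((U : Filter ι).Germ ℚ_[p]) :=
    fun U ↦ (padicLike_germValuation (p := p) (U := U)).charZero
  have := hchar U
  obtain ⟨F, _, i₁, i₂, hc, hle, hmax⟩ := hG.exists_maximal
  by_cases hx : ∃ a, i₁ a = x
  · obtain ⟨a, rfl⟩ := hx
    exact ⟨ι, U, RingHom.id _, _, isPowRelation_range hc, fun a b hab ↦ hle hab, i₂ a, a, rfl⟩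
  · push Not at hx
    obtain ⟨z, a, hza, 𝓕, h𝓕, happ⟩ :=
      hc.exists_approximates h₁ padicLike_germValuation hmax hx
    have happ' : Approximates i₁ z (Ultrafilter.of 𝓕 : Filter F) :=
      fun g hg M hM ↦ Ultrafilter.of_le 𝓕 (happ g hg M hM)
    have hadj := Approximates.exists_isAdjoinable h₁ hc happ'
    set V := Ultrafilter.of 𝓕
    set h := (germFlatten V U).comp (Pi.constRingHom F ((U : Filter ι).Germ ℚ_[p]))
    have := hchar (V.iterate U)
    obtain ⟨F', _, i₁', i₂', hc', hle'⟩ := hadj.isPowRelation_range.exists_field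
    have hmem : ∀ g : F[X], ∃ b, i₁' b = g.eval₂ i₁ z ∧
        i₂' b = g.eval₂ (h.comp i₂) (germFlatten V U i₂) := by
      intro g
      obtain ⟨b, hb⟩ := hle' ⟨g, rfl⟩
      exact ⟨b, congrArg Prod.fst hb, congrArg Prod.snd hb⟩
    refine ⟨F × ι, V.iterate U, h, _, isPowRelation_range hc', ?_, ?_⟩
    · intro c d hcd
      obtain ⟨e, he⟩ := hle hcd
      obtain ⟨b, hb1, hb2⟩ := hmem (C e)
      refine ⟨b, Prod.ext ?_ ?_⟩
      · have := congrArg Prod.fst he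
        simpa [hb1] using this
      · have := congrArg Prod.snd he
        change i₂' b = h d
        rw [hb2, eval₂_C, RingHom.comp_apply]
        exact congrArg h this
    · obtain ⟨b, hb1, -⟩ := hmem (C a)
      obtain ⟨b', hb1', -⟩ := hmem X
      rw [eval₂_C] at hb1
      rw [eval₂_X] at hb1'
      rcases hza with hza | hza
      · exact ⟨i₂' (b' + b), b' + b, Prod.ext (by simp [hb1, hb1', hza]) rfl⟩
      · exact ⟨i₂' (b'⁻¹ + b), b'⁻¹ + b, Prod.ext (by simp [hb1, hb1', hza]) rfl⟩

theorem IsPowRelation.exists_extension_finset {K₁ Γ₁ : Type v} [Field K₁]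
    [LinearOrderedCommGroupWithZero Γ₁] {v₁ : Valuation K₁ Γ₁} (h₁ : PadicLike p v₁) {ι : Type v}
    {U : Ultrafilter ι} {G : Subring (K₁ × (U : Filter ι).Germ ℚ_[p])} (hG : IsPowRelation G)
    (A : Finset K₁) : ∃ (ι' : Type v) (U' : Ultrafilter ι')
      (h : (U : Filter ι).Germ ℚ_[p] →+* (U' : Filter ι').Germ ℚ_[p])
      (G' : Subring (K₁ × (U' : Filter ι').Germ ℚ_[p])), IsPowRelation G' ∧
      (∀ a b, (a, b) ∈ G → (a, h b) ∈ G') ∧ ∀ x ∈ A, ∃ y, (x, y) ∈ G' := by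
  classical
  induction A using Finset.induction_on with
  | empty => exact ⟨ι, U, RingHom.id _, G, hG, fun a b hab ↦ hab, by simp⟩
  | insert x A _ ih =>
    obtain ⟨ι', U', h, G', hG', hGG', hA⟩ := ih
    obtain ⟨ι'', U'', h', G'', hG'', hGG'', y, hy⟩ := hG'.exists_extension h₁ x
    refine ⟨ι'', U'', h'.comp h, G'', hG'', fun a b hab ↦ hGG'' _ _ (hGG' _ _ hab), ?_⟩
    intro x' hx'
    rcases Finset.mem_insert.1 hx' with rfl | hx'
    · exact ⟨y, hy⟩
    · obtain ⟨y', hy'⟩ := hA x' hx'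
      exact ⟨_, hGG'' _ _ hy'⟩

end Extension

section Amalgamation

variable {p : ℕ} [Fact p.Prime]

theorem PadicLike.isPow_map_iff {K₁ K₂ Γ₁ Γ₂ : Type*} [Field K₁] [Field K₂]
    [LinearOrderedCommGroupWithZero Γ₁] [LinearOrderedCommGroupWithZero Γ₂]
    {v₁ : Valuation K₁ Γ₁} {v₂ : Valuation K₂ Γ₂} (h₁ : PadicLike p v₁) (h₂ : PadicLike p v₂)
    (φ : K₁ →+* K₂) {m : ℕ} (hm : m ≠ 0) {x : K₁} (hx : x ≠ 0) :
    (∃ y, φ x = y ^ m) ↔ ∃ y, x = y ^ m := by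
  obtain ⟨q, hq, w, hw⟩ := h₁.exists_eq m hm x hx
  have hw0 : w ≠ 0 := by
    rintro rfl
    exact hx (by rw [hw, zero_pow hm, mul_zero])
  have : SamePowClass m x (φ x) :=
    ⟨q, hq, w, φ w, hw0, by simpa using hw0, hw, by rw [hw]; simp⟩
  exact (this.isPow_iff h₁ h₂ hm).symm

theorem powCompat_of_isPow_iff {F K₁ K₂ Γ₁ Γ₂ : Type*} [Field F] [Field K₁] [Field K₂]
    [LinearOrderedCommGroupWithZero Γ₁] [LinearOrderedCommGroupWithZero Γ₂]
    {v₁ : Valuation K₁ Γ₁} {v₂ : Valuation K₂ Γ₂} (h₁ : PadicLike p v₁) (h₂ : PadicLike p v₂)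
    {i₁ : F →+* K₁} {i₂ : F →+* K₂}
    (h : ∀ m, m ≠ 0 → ∀ a, a ≠ 0 → ((∃ y, i₁ a = y ^ m) ↔ ∃ y, i₂ a = y ^ m)) :
    PowCompat i₁ i₂ := by
  intro a ha n hn
  have := h₁.charZero
  have := h₂.charZero
  have ha₁ : i₁ a ≠ 0 := by simpa using ha
  have ha₂ : i₂ a ≠ 0 := by simpa using ha
  obtain ⟨q, hq, s, hs⟩ := h₁.exists_eq n hn _ ha₁
  have hq₁ : (q : K₁) ≠ 0 := by exact_mod_cast hq
  have hq₂ : (q : K₂) ≠ 0 := by exact_mod_cast hq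
  have hqF : (q : F) ≠ 0 := fun h0 ↦ hq₁ (by rw [← map_natCast i₁, h0, map_zero])
  obtain ⟨t, ht⟩ := (h n hn (a / q) (div_ne_zero ha hqF)).1
    ⟨s, by rw [map_div₀, map_natCast, hs, mul_div_cancel_left₀ _ hq₁]⟩
  rw [map_div₀, map_natCast, div_eq_iff hq₂, mul_comm] at ht
  refine ⟨q, hq, s, t, ?_, ?_, hs, ht⟩
  · rintro rfl
    exact ha₁ (by rw [hs, zero_pow hn, mul_zero])
  · rintro rfl
    exact ha₂ (by rw [ht, zero_pow hn, mul_zero])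

/-- A family of maps that is eventually multiplicative and additive at each pair of elements gives
a ring homomorphism to the ring of germs. -/
theorem Filter.Germ.exists_ringHom {ι R β : Type*} [Ring R] [Ring β] {l : Filter ι} {e : ι → R → β}
    (h1 : ∀ᶠ j in l, e j 1 = 1) (h0 : ∀ᶠ j in l, e j 0 = 0)
    (hmul : ∀ a b, ∀ᶠ j in l, e j (a * b) = e j a * e j b)
    (hadd : ∀ a b, ∀ᶠ j in l, e j (a + b) = e j a + e j b) :
    ∃ g : R →+* l.Germ β, ∀ a, g a = ((fun j ↦ e j a : ι → β) : l.Germ β) :=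
  ⟨⟨⟨⟨fun a ↦ ((fun j ↦ e j a : ι → β) : l.Germ β), Germ.coe_eq.2 h1⟩,
    fun a b ↦ Germ.coe_eq.2 (hmul a b)⟩, Germ.coe_eq.2 h0, fun a b ↦ Germ.coe_eq.2 (hadd a b)⟩,
    fun _ ↦ rfl⟩

universe v

variable {K₁ Γ₁ ι : Type v} [Field K₁] [LinearOrderedCommGroupWithZero Γ₁] {v₁ : Valuation K₁ Γ₁}
  {U : Ultrafilter ι} {G : Subring (K₁ × (U : Filter ι).Germ ℚ_[p])}

theorem IsPowRelation.exists_partial_homs (h₁ : PadicLike p v₁) (hG : IsPowRelation G)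
    (A : Finset K₁) (B : Finset ((U : Filter ι).Germ ℚ_[p]))
    (C : Finset (K₁ × (U : Filter ι).Germ ℚ_[p])) :
    ∃ (e₁ : K₁ → ℚ_[p]) (e₂ : (U : Filter ι).Germ ℚ_[p] → ℚ_[p]),
      (e₁ 1 = 1 ∧ e₁ 0 = 0 ∧ ∀ a ∈ A, ∀ b ∈ A,
        e₁ (a * b) = e₁ a * e₁ b ∧ e₁ (a + b) = e₁ a + e₁ b) ∧
      (e₂ 1 = 1 ∧ e₂ 0 = 0 ∧ ∀ a ∈ B, ∀ b ∈ B,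
        e₂ (a * b) = e₂ a * e₂ b ∧ e₂ (a + b) = e₂ a + e₂ b) ∧
      ∀ c ∈ C, c ∈ G → e₁ c.1 = e₂ c.2 := by
  classical
  have := h₁.charZero
  obtain ⟨ι', U', h, G', hG', hGG', hA'⟩ := hG.exists_extension_finset h₁
    (A ∪ (Finset.image₂ (· * ·) A A ∪ (Finset.image₂ (· + ·) A A)))
  have hex : ∀ a, ∃ y, (∃ y, (a, y) ∈ G') → (a, y) ∈ G' := fun a ↦ by
    by_cases ha : ∃ y, (a, y) ∈ G'
    · exact ha.imp fun y hy _ ↦ hy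
    · exact ⟨0, fun h ↦ absurd h ha⟩
  choose Y hY using hex
  have huniq : ∀ {a y}, (a, y) ∈ G' → Y a = y := fun ha ↦ hG'.snd_unique (hY _ ⟨_, ha⟩) ha
  have hYA : ∀ a ∈ A, (a, Y a) ∈ G' := fun a ha ↦
    hY a (hA' a (Finset.mem_union_left _ ha))
  have e1 : ∀ᶠ j in (U' : Filter ι'), (Y 1).rep j = 1 := by
    rw [huniq (y := 1) G'.one_mem]
    exact Germ.eventually_rep_one _
  have e2 : ∀ᶠ j in (U' : Filter ι'), (Y 0).rep j = 0 := by
    rw [huniq (y := 0) G'.zero_mem]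
    exact Germ.eventually_rep_zero _
  have e3 : ∀ᶠ j in (U' : Filter ι'), ∀ a ∈ A, ∀ b ∈ A,
      (Y (a * b)).rep j = (Y a).rep j * (Y b).rep j ∧
      (Y (a + b)).rep j = (Y a).rep j + (Y b).rep j := by
    simp only [Filter.eventually_all_finset]
    intro a ha b hb
    rw [huniq (a := a * b) (G'.mul_mem (hYA a ha) (hYA b hb)),
      huniq (a := a + b) (G'.add_mem (hYA a ha) (hYA b hb))]
    exact (Germ.eventually_rep_mul _ _).and (Germ.eventually_rep_add _ _)
  have e4 : ∀ᶠ j in (U' : Filter ι'), (h 1).rep j = 1 := by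
    rw [map_one]
    exact Germ.eventually_rep_one _
  have e5 : ∀ᶠ j in (U' : Filter ι'), (h 0).rep j = 0 := by
    rw [map_zero]
    exact Germ.eventually_rep_zero _
  have e6 : ∀ᶠ j in (U' : Filter ι'), ∀ a ∈ B, ∀ b ∈ B,
      (h (a * b)).rep j = (h a).rep j * (h b).rep j ∧
      (h (a + b)).rep j = (h a).rep j + (h b).rep j := by
    simp only [Filter.eventually_all_finset]
    intro a ha b hb
    rw [map_mul, map_add]
    exact (Germ.eventually_rep_mul _ _).and (Germ.eventually_rep_add _ _)
  obtain ⟨j, h1, h2, h3, h4, h5, h6⟩ :=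
    (e1.and (e2.and (e3.and (e4.and (e5.and e6))))).exists
  refine ⟨fun a ↦ (Y a).rep j, fun b ↦ (h b).rep j, ⟨h1, h2, h3⟩, ⟨h4, h5, h6⟩, fun c _ hc ↦ ?_⟩
  exact congrArg (fun y ↦ Germ.rep y j) (huniq (hGG' c.1 c.2 hc))

/-- Paired elements of two fields can be identified in a common ultrapower of the `p`-adic
numbers. -/
theorem IsPowRelation.exists_common_extension (h₁ : PadicLike p v₁) (hG : IsPowRelation G) :
    ∃ (κ : Type v) (V : Ultrafilter κ) (g₁ : K₁ →+* (V : Filter κ).Germ ℚ_[p])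
      (g₂ : (U : Filter ι).Germ ℚ_[p] →+* (V : Filter κ).Germ ℚ_[p]),
      ∀ c ∈ G, g₁ c.1 = g₂ c.2 := by
  classical
  let κ := Finset K₁ × Finset ((U : Filter ι).Germ ℚ_[p]) ×
    Finset (K₁ × (U : Filter ι).Germ ℚ_[p])
  choose e₁ e₂ h₁ h₂ h₁₂ using fun S : κ ↦ hG.exists_partial_homs h₁ S.1 S.2.1 S.2.2
  let V : Ultrafilter κ := Ultrafilter.of atTop
  have hV : ∀ S₀ : κ, ∀ᶠ S in (V : Filter κ), S₀ ≤ S := fun S₀ ↦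
    Ultrafilter.of_le _ (eventually_ge_atTop S₀)
  have hA : ∀ a b : K₁, ∀ᶠ S in (V : Filter κ), a ∈ S.1 ∧ b ∈ S.1 := fun a b ↦
    (hV ({a, b}, ∅, ∅)).mono fun S hS ↦ ⟨hS.1 (by simp), hS.1 (by simp)⟩
  have hB : ∀ a b : (U : Filter ι).Germ ℚ_[p], ∀ᶠ S in (V : Filter κ), a ∈ S.2.1 ∧ b ∈ S.2.1 :=
    fun a b ↦ (hV (∅, {a, b}, ∅)).mono fun S hS ↦ ⟨hS.2.1 (by simp), hS.2.1 (by simp)⟩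
  have hC : ∀ c : K₁ × (U : Filter ι).Germ ℚ_[p], ∀ᶠ S in (V : Filter κ), c ∈ S.2.2 := fun c ↦
    (hV (∅, ∅, {c})).mono fun S hS ↦ hS.2.2 (by simp)
  obtain ⟨g₁, hg₁⟩ := Germ.exists_ringHom (l := V) (e := e₁)
    (Eventually.of_forall fun S ↦ (h₁ S).1) (Eventually.of_forall fun S ↦ (h₁ S).2.1)
    (fun a b ↦ (hA a b).mono fun S hS ↦ ((h₁ S).2.2 a hS.1 b hS.2).1)
    (fun a b ↦ (hA a b).mono fun S hS ↦ ((h₁ S).2.2 a hS.1 b hS.2).2)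
  obtain ⟨g₂, hg₂⟩ := Germ.exists_ringHom (l := V) (e := e₂)
    (Eventually.of_forall fun S ↦ (h₂ S).1) (Eventually.of_forall fun S ↦ (h₂ S).2.1)
    (fun a b ↦ (hB a b).mono fun S hS ↦ ((h₂ S).2.2 a hS.1 b hS.2).1)
    (fun a b ↦ (hB a b).mono fun S hS ↦ ((h₂ S).2.2 a hS.1 b hS.2).2)
  refine ⟨κ, V, g₁, g₂, fun c hc ↦ ?_⟩
  rw [hg₁, hg₂]
  exact Germ.coe_eq.2 ((hC c).mono fun S hS ↦ h₁₂ S c hS hc)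

end Amalgamation

theorem isNonzeroPow_map_iff {L K : Type*} [Field L] [Field K] (f : L →+* K) (m : ℕ) (x : L) :
    IsNonzeroPow m (f x) ↔ x ≠ 0 ∧ ∃ y, f x = y ^ m := by
  rw [IsNonzeroPow, _root_.map_ne_zero]

end

theorem stmt9 (p : ℕ) [Fact p.Prime] {Ω : Type u} [Field Ω] [CharZero Ω]
    (L₁ L₂ k₀ : Subfield Ω) (hk₁ : k₀ ≤ L₁) (hk₂ : k₀ ≤ L₂)
    (hdisj : LinearDisjointOver k₀ L₁ L₂)
    (K₁ K₂ : Type*) [Field K₁] [Field K₂]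
    (he₁ : ElemEquivToQp p K₁) (he₂ : ElemEquivToQp p K₂)
    (f₁ : L₁ →+* K₁) (f₂ : L₂ →+* K₂)
    (hcompat : ∀ m : ℕ, 1 ≤ m → ∀ a : Ω, ∀ ha : a ∈ k₀,
      (IsNonzeroPow m (f₁ ⟨a, hk₁ ha⟩) ↔ IsNonzeroPow m (f₂ ⟨a, hk₂ ha⟩))) :
    ∃ (K : Type u) (_ : Field K), ElemEquivToQp p K ∧
      ∃ (g₁ : L₁ →+* K) (g₂ : L₂ →+* K),
        (∀ a : Ω, ∀ ha : a ∈ k₀, g₁ ⟨a, hk₁ ha⟩ = g₂ ⟨a, hk₂ ha⟩) ∧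
        (∀ m : ℕ, 1 ≤ m → ∀ x : L₁,
          (IsNonzeroPow m (g₁ x) ↔ IsNonzeroPow m (f₁ x))) ∧
        (∀ m : ℕ, 1 ≤ m → ∀ x : L₂,
          (IsNonzeroPow m (g₂ x) ↔ IsNonzeroPow m (f₂ x))) := by
  obtain ⟨ι₁, U₁, e₁, hpow₁⟩ := he₁.exists_germ_embedding f₁
  obtain ⟨ι₂, U₂, e₂, hpow₂⟩ := he₂.exists_germ_embedding f₂
  have hc : PowCompat (e₁.comp (Subfield.inclusion hk₁)) (e₂.comp (Subfield.inclusion hk₂)) := by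
    refine powCompat_of_isPow_iff padicLike_germValuation padicLike_germValuation ?_
    intro m hm a ha
    have ha₁ : Subfield.inclusion hk₁ a ≠ 0 := by simpa using ha
    have ha₂ : Subfield.inclusion hk₂ a ≠ 0 := by simpa using ha
    have h := hcompat m (Nat.one_le_iff_ne_zero.2 hm) a a.2
    rw [isNonzeroPow_map_iff, isNonzeroPow_map_iff] at h
    rw [RingHom.comp_apply, RingHom.comp_apply, hpow₁, hpow₂]
    exact ⟨fun h' ↦ (h.1 ⟨ha₁, h'⟩).2, fun h' ↦ (h.2 ⟨ha₂, h'⟩).2⟩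
  obtain ⟨κ, V, g₁, g₂, hg⟩ :=
    (isPowRelation_range hc).exists_common_extension padicLike_germValuation
  refine ⟨(V : Filter κ).Germ ℚ_[p], inferInstance, elemEquivToQp_germ p V, g₁.comp e₁,
    g₂.comp e₂, fun a ha ↦ hg _ ⟨⟨a, ha⟩, rfl⟩, fun m hm x ↦ ?_, fun m hm x ↦ ?_⟩
  · rw [isNonzeroPow_map_iff, isNonzeroPow_map_iff, ← hpow₁]
    refine and_congr_right fun hx ↦ ?_
    exact padicLike_germValuation.isPow_map_iff padicLike_germValuation g₁
      (Nat.one_le_iff_ne_zero.1 hm) (by simpa using hx)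
  · rw [isNonzeroPow_map_iff, isNonzeroPow_map_iff, ← hpow₂]
    refine and_congr_right fun hx ↦ ?_
    exact padicLike_germValuation.isPow_map_iff padicLike_germValuation g₂
      (Nat.one_le_iff_ne_zero.1 hm) (by simpa using hx)
end
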